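/- (Sturm Comparison Theorem II) Assume α is strictly increasing on (a,b), β₁, β₂ ∈ BV_loc((a,b),ℝ), and ω₁(x) ≠ 0 and ω₂(x) ≠ 0 for all x ∈ (a,b). Let u and v be nontrivial real-valued balanced solutions of −d(dy/dα) + y dβ₁ = 0 and −d(dy/dα) + y dβ₂ = 0 on (a,b), respectively, and let s < t be consecutive points of Z_{(a,b)}(u). Then: (1) if u^-(s) u^+(s) < 0, u^-(t) = 0, ω₁(s) > 0, and d(β₁−β₂) is a positive measure on [s,t), then v changes sign in [s,t); (2) if u^+(s) = 0, u^-(t) u^+(t) < 0, ω₁(t) > 0, and d(β₁−β₂) is a positive measure on (s,t], then v changes sign in (s,t]; (3) if u^-(s) u^+(s) < 0, u^+(t) = 0, ω₁(s) > 0, ω₁(t) > 0, and d(β₁−β₂) is a positive measure on [s,t], then v changes sign in [s,t]; (4) if u^-(s) = 0, u^-(t) u^+(t) < 0, ω₁(s) > 0, ω₁(t) > 0, and d(β₁−β₂) is a positive measure on [s,t], then v changes sign in [s,t]; (5) if u^-(s) u^+(s) < 0, u^-(t) u^+(t) < 0, ω₁(s) > 0, ω₁(t) > 0, and d(β₁−β₂)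 is a positive measure on [s,t], then v changes sign in [s,t]. -/

import Mathlib

open Set Filter Function MeasureTheory Topology

noncomputable section

/-- The open interval `(a,b) ⊆ ℝ` determined by extended-real endpoints `a`, `b`. -/
def EI (a b : EReal) : Set ℝ := {x : ℝ | a < (x : EReal) ∧ (x : EReal) < b}

/-- The jump `Δ_{df}(x) = f⁺(x) - f⁻(x)` of a real-valued function. -/
def jump (f : ℝ → ℝ) (x : ℝ) : ℝ := rightLim f x - leftLim f x

/-- The jump `Δ_{df}(x) = f⁺(x) - f⁻(x)` of a complex-valued function. -/
def jumpC (f : ℝ → ℂ) (x : ℝ) : ℂ := rightLim f x - leftLim f x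

/-- `θ_z(x) = 1 - z² Δ_{dα}(x) Δ_{dβ}(x)`. -/
def theta (α β : ℝ → ℝ) (z x : ℝ) : ℝ := 1 - z ^ 2 * jump α x * jump β x

/-- `ω(x) = 1 - Δ_{dα}(x) Δ_{dβ}(x) / 4`. -/
def omegaFn (α β : ℝ → ℝ) (x : ℝ) : ℝ := 1 - jump α x * jump β x / 4

/-- A real-valued function is `r`-balanced on `I`: it is of locally bounded variation and
`f(x) = r f⁻(x) + (1-r) f⁺(x)` for all `x ∈ I`. -/
def RBalanced (r : ℝ) (I : Set ℝ) (f : ℝ → ℝ) : Prop :=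
  LocallyBoundedVariationOn f I ∧
    ∀ x ∈ I, f x = r * leftLim f x + (1 - r) * rightLim f x

/-- A complex-valued function is `r`-balanced on `I`. -/
def RBalancedC (r : ℂ) (I : Set ℝ) (f : ℝ → ℂ) : Prop :=
  LocallyBoundedVariationOn f I ∧
    ∀ x ∈ I, f x = r * leftLim f x + (1 - r) * rightLim f x

/-- `ν` coincides on `[c,d]` with the Lebesgue–Stieltjes measure `df` generated by `f`,
determined by `df((x,y]) = f⁺(y) - f⁺(x)`. -/
def SMRepresents (ν : SignedMeasure ℝ) (f : ℝ → ℝ) (c d : ℝ) : Prop :=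
  ∀ x ∈ Icc c d, ∀ y ∈ Icc c d, x ≤ y → ν (Ioc x y) = rightLim f y - rightLim f x

/-- The integral of `h` against the signed measure `ν` over the set `E`. -/
def sInt (ν : SignedMeasure ℝ) (h : ℝ → ℝ) (E : Set ℝ) : ℝ :=
  (∫ x in E, h x ∂ν.toJordanDecomposition.posPart) -
    (∫ x in E, h x ∂ν.toJordanDecomposition.negPart)

/-- The equality of (locally finite, real Borel) measures `dg = ∑ j, (h j) d(β j)` on the
interval `I`, expressed via localizations to compact subintervals of `I`. -/
def MeasureEqOn (I : Set ℝ) {ι : Type} [Fintype ι] (g : ℝ → ℝ) (h β : ι → ℝ → ℝ) : Prop :=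
  ∀ c ∈ I, ∀ d ∈ I, c < d →
    ∃ (νg : SignedMeasure ℝ) (ν : ι → SignedMeasure ℝ),
      SMRepresents νg g c d ∧ (∀ j, SMRepresents (ν j) (β j) c d) ∧
      ∀ E : Set ℝ, E ⊆ Ioc c d → MeasurableSet E → νg E = ∑ j, sInt (ν j) (h j) E

/-- The equality of complex measures `dg = ∑ j, (h j) d(β j)` on `I`, encoded via real and
imaginary parts. -/
def MeasureEqOnC (I : Set ℝ) {ι : Type} [Fintype ι] (g : ℝ → ℂ) (h β : ι → ℝ → ℂ) : Prop :=
  MeasureEqOn I (fun x => (g x).re)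
    (Sum.elim (fun j x => (h j x).re) (fun j x => -(h j x).im))
    (Sum.elim (fun j x => (β j x).re) (fun j x => (β j x).im)) ∧
  MeasureEqOn I (fun x => (g x).im)
    (Sum.elim (fun j x => (h j x).im) (fun j x => (h j x).re))
    (Sum.elim (fun j x => (β j x).re) (fun j x => (β j x).im))

/-- The support of `dα` is all of `I`: no open subinterval of `I` is `dα`-null, i.e. on no
open subinterval of `I` do all one-sided limits of `α` coincide with a single constant. -/
def SuppFull (I : Set ℝ) (α : ℝ → ℂ) : Prop :=
  ∀ x ∈ I, ∀ ε > (0 : ℝ), Icc (x - ε) (x + ε) ⊆ I →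
    ¬ (∀ p ∈ Ioo (x - ε) (x + ε), ∀ q ∈ Ioo (x - ε) (x + ε),
        rightLim α p = rightLim α q ∧ leftLim α p = rightLim α q)

/-- `u`, together with the representative `w` of `du/dα`, is an `r`-balanced solution of the
homogeneous equation `-d(du/dα) + u dβ = 0` on `I`: `u` and `w` are `r`-balanced,
`du = w dα` (so `du ≪ dα` with `du/dα = w`), and `dw = u dβ`. -/
def IsHomSol (I : Set ℝ) (r : ℝ) (α β u w : ℝ → ℝ) : Prop :=
  RBalanced r I u ∧ RBalanced r I w ∧
  MeasureEqOn I u (fun _ : Fin 1 => w) (fun _ => α) ∧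
  MeasureEqOn I w (fun _ : Fin 1 => u) (fun _ => β)

/-- `u`, together with the representative `w` of `du/dα`, is an `r`-balanced solution of
`-d(du/dα) + u dβ = dη` on `I` (complex-valued coefficients): `dw = u dβ - dη`. -/
def IsSolC (I : Set ℝ) (r : ℂ) (α β η u w : ℝ → ℂ) : Prop :=
  RBalancedC r I u ∧ RBalancedC r I w ∧
  MeasureEqOnC I u (fun _ : Fin 1 => w) (fun _ => α) ∧
  MeasureEqOnC I w ![u, fun _ => (-1 : ℂ)] ![β, η]

/-- `y` solves the linear system `dy = dφ · y + dψ` on `I`, componentwise: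
`d(y i) = ∑ j, (y j) d(φ i j) + dψ i`. -/
def IsSysSolC (I : Set ℝ) (n : ℕ) (φ : ℝ → Matrix (Fin n) (Fin n) ℂ)
    (ψ : ℝ → Fin n → ℂ) (y : ℝ → Fin n → ℂ) : Prop :=
  ∀ i : Fin n,
    MeasureEqOnC I (fun x => y x i)
      (Sum.elim (fun j : Fin n => fun x => y x j) (fun _ : Unit => fun _ => (1 : ℂ)))
      (Sum.elim (fun j : Fin n => fun x => φ x i j) (fun _ : Unit => fun x => ψ x i))

/-- `Z_I(f) = {x ∈ I : f⁻(x) f⁺(x) ≤ 0}`, the set of sign-changing points of `f` in `I`. -/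
def ZSet (f : ℝ → ℝ) (I : Set ℝ) : Set ℝ := {x ∈ I | leftLim f x * rightLim f x ≤ 0}

/-- `u` changes sign at `s ∈ I`. -/
def ChangesSignAt (I : Set ℝ) (u : ℝ → ℝ) (s : ℝ) : Prop :=
  ∃ δ > (0 : ℝ), Ioo (s - δ) (s + δ) ⊆ I ∧
    (((∀ x ∈ Ioo (s - δ) s, leftLim u x < 0) ∧ ∀ x ∈ Ioo s (s + δ), 0 < rightLim u x) ∨
     ((∀ x ∈ Ioo (s - δ) s, 0 < leftLim u x) ∧ ∀ x ∈ Ioo s (s + δ), rightLim u x < 0))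

/-- `u` changes sign in `J` (a subinterval of `I`). -/
def ChangesSignIn (I : Set ℝ) (u : ℝ → ℝ) (J : Set ℝ) : Prop :=
  ∃ s ∈ J, ChangesSignAt I u s

/-- `u` and `v` are linearly dependent on `I`. -/
def LinDepOn (I : Set ℝ) (u v : ℝ → ℝ) : Prop :=
  ∃ c₁ c₂ : ℝ, ¬(c₁ = 0 ∧ c₂ = 0) ∧ ∀ x ∈ I, c₁ * u x + c₂ * v x = 0

/-- The Lebesgue–Stieltjes measure `dg` is nonnegative on (Borel subsets of) `S`, expressed by
nonnegativity on all subintervals of `S` of each of the four kinds. -/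
def PosMeasureOn (g : ℝ → ℝ) (S : Set ℝ) : Prop :=
  (∀ x y : ℝ, x ≤ y → Icc x y ⊆ S → 0 ≤ rightLim g y - leftLim g x) ∧
  (∀ x y : ℝ, x ≤ y → Ico x y ⊆ S → 0 ≤ leftLim g y - leftLim g x) ∧
  (∀ x y : ℝ, x ≤ y → Ioc x y ⊆ S → 0 ≤ rightLim g y - rightLim g x) ∧
  (∀ x y : ℝ, x < y → Ioo x y ⊆ S → 0 ≤ leftLim g y - rightLim g x)

/-- The one-sided limits of `f` exist at every point of `I`. -/
def HasOneSidedLims (f : ℝ → ℝ) (I : Set ℝ) : Prop :=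
  ∀ x ∈ I, Tendsto f (𝓝[<] x) (𝓝 (leftLim f x)) ∧ Tendsto f (𝓝[>] x) (𝓝 (rightLim f x))

lemma HasOneSidedLims.mono {f : ℝ → ℝ} {I J : Set ℝ} (h : HasOneSidedLims f I) (hJ : J ⊆ I) :
    HasOneSidedLims f J := fun x hx => h x (hJ hx)

lemma isOpen_EI (a b : EReal) : IsOpen (EI a b) :=
  (isOpen_lt continuous_const continuous_coe_real_ereal).inter
    (isOpen_lt continuous_coe_real_ereal continuous_const)

lemma Icc_subset_EI {a b : EReal} {x y : ℝ} (hx : x ∈ EI a b) (hy : y ∈ EI a b) :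
    Icc x y ⊆ EI a b := fun _ hz =>
  ⟨hx.1.trans_le (EReal.coe_le_coe_iff.2 hz.1), (EReal.coe_le_coe_iff.2 hz.2).trans_lt hy.2⟩

lemma hasOneSidedLims_of_locallyBoundedVariationOn {f : ℝ → ℝ} {a b : EReal}
    (hf : LocallyBoundedVariationOn f (EI a b)) : HasOneSidedLims f (EI a b) := by
  intro x hx
  obtain ⟨ε, hε, hsub⟩ := Metric.isOpen_iff.1 (isOpen_EI a b) x hx
  have hp : x - ε / 2 ∈ EI a b := hsub (by simp [abs_of_pos hε, hε])
  have hq : x + ε / 2 ∈ EI a b := hsub (by simp [abs_of_pos hε, hε])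
  have hbv := hf _ _ hp hq
  rw [inter_eq_right.2 (Icc_subset_EI hp hq)] at hbv
  constructor
  · apply tendsto_leftLim_of_tendsto
    obtain ⟨l, hl⟩ := hbv.exists_tendsto_left x
    refine ⟨l, hl.mono_left ?_⟩
    rw [inter_comm, nhdsWithin_inter_of_mem']
    exact mem_nhdsWithin_of_mem_nhds (Icc_mem_nhds (by linarith) (by linarith))
  · apply tendsto_rightLim_of_tendsto
    obtain ⟨l, hl⟩ := hbv.exists_tendsto_right x
    refine ⟨l, hl.mono_left ?_⟩
    rw [inter_comm, nhdsWithin_inter_of_mem']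
    exact mem_nhdsWithin_of_mem_nhds (Icc_mem_nhds (by linarith) (by linarith))

lemma tendsto_leftLim_nhdsGT {f : ℝ → ℝ} {x l : ℝ} (h : Tendsto f (𝓝[>] x) (𝓝 l)) :
    Tendsto (leftLim f) (𝓝[>] x) (𝓝 l) := by
  have hl : rightLim f x = l := rightLim_eq_of_tendsto h
  subst hl
  apply (closed_nhds_basis (f.rightLim x)).tendsto_right_iff.2
  rintro s ⟨s_mem, s_closed⟩
  obtain ⟨u, au, hu⟩ := mem_nhdsGT_iff_exists_Ioo_subset.1 (h s_mem)
  filter_upwards [Ioo_mem_nhdsGT au] with c hc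
  by_cases hex : ∃ y, Tendsto f (𝓝[<] c) (𝓝 y)
  · apply s_closed.mem_of_tendsto (tendsto_leftLim_of_tendsto hex)
    filter_upwards [Ioo_mem_nhdsLT_of_mem ⟨hc.1, hc.2.le⟩] with z hz using hu hz
  · simpa [leftLim_eq_of_not_tendsto _ hex] using hu hc

lemma tendsto_rightLim_nhdsLT {f : ℝ → ℝ} {x l : ℝ} (h : Tendsto f (𝓝[<] x) (𝓝 l)) :
    Tendsto (rightLim f) (𝓝[<] x) (𝓝 l) := by
  have hl : leftLim f x = l := leftLim_eq_of_tendsto h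
  subst hl
  apply (closed_nhds_basis (f.leftLim x)).tendsto_right_iff.2
  rintro s ⟨s_mem, s_closed⟩
  obtain ⟨u, au, hu⟩ := mem_nhdsLT_iff_exists_Ioo_subset.1 (h s_mem)
  filter_upwards [Ioo_mem_nhdsLT au] with c hc
  by_cases hex : ∃ y, Tendsto f (𝓝[>] c) (𝓝 y)
  · apply s_closed.mem_of_tendsto (tendsto_rightLim_of_tendsto hex)
    filter_upwards [Ioo_mem_nhdsGT_of_mem ⟨hc.1.le, hc.2⟩] with z hz using hu hz
  · simpa [rightLim_eq_of_not_tendsto _ hex] using hu hc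

lemma tendsto_rightLim_nhdsGT {f : ℝ → ℝ} {x l : ℝ} (h : Tendsto f (𝓝[>] x) (𝓝 l)) :
    Tendsto (rightLim f) (𝓝[>] x) (𝓝 l) := by
  have hl : rightLim f x = l := rightLim_eq_of_tendsto h
  subst hl
  exact (continuousWithinAt_rightLim_Ici h).mono Ioi_subset_Ici_self

lemma tendsto_leftLim_nhdsLT {f : ℝ → ℝ} {x l : ℝ} (h : Tendsto f (𝓝[<] x) (𝓝 l)) :
    Tendsto (leftLim f) (𝓝[<] x) (𝓝 l) := by
  have hl : leftLim f x = l := leftLim_eq_of_tendsto h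
  subst hl
  exact (continuousWithinAt_leftLim_Iic h).mono Iio_subset_Iic_self

/-- Consequences on the open interval `(c,d)` of the measure equation `dg = h dβ`: the equality of
atoms, and an estimate of the masses of open intervals by a dominating measure `M`. -/
structure StieltjesEq (M : Measure ℝ) (c d : ℝ) (g h β : ℝ → ℝ) : Prop where
  jump_eq : ∀ x ∈ Ioo c d, rightLim g x - leftLim g x = h x * (rightLim β x - leftLim β x)
  abs_sub_le : ∀ x y k K : ℝ, c < x → x < y → y < d → (∀ z ∈ Ioo x y, |h z - k| ≤ K) →
    |leftLim g y - rightLim g x - k * (leftLim β y - rightLim β x)| ≤ K * M.real (Ioo x y)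

lemma StieltjesEq.mono {M N : Measure ℝ} [IsFiniteMeasure N] {c d : ℝ} {g h β : ℝ → ℝ}
    (H : StieltjesEq M c d g h β) (hMN : M ≤ N) : StieltjesEq N c d g h β := by
  refine ⟨H.jump_eq, fun x y k K hx hxy hy hK => (H.abs_sub_le x y k K hx hxy hy hK).trans ?_⟩
  obtain ⟨z, hz⟩ := nonempty_Ioo.2 hxy
  have hK0 : 0 ≤ K := (abs_nonneg _).trans (hK z hz)
  gcongr
  exact ENNReal.toReal_mono (measure_ne_top _ _) (hMN _)

lemma StieltjesEq.neg {M : Measure ℝ} {c d : ℝ} {g h β : ℝ → ℝ} (H : StieltjesEq M c d g h β)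
    (hg : HasOneSidedLims g (Ioo c d)) : StieltjesEq M c d (-g) (-h) β := by
  have hl : ∀ x ∈ Ioo c d, leftLim (-g) x = -leftLim g x := fun x hx =>
    leftLim_eq_of_tendsto (hg x hx).1.neg
  have hr : ∀ x ∈ Ioo c d, rightLim (-g) x = -rightLim g x := fun x hx =>
    rightLim_eq_of_tendsto (hg x hx).2.neg
  refine ⟨fun x hx => ?_, fun x y k K hx hxy hy hK => ?_⟩
  · rw [hl x hx, hr x hx, Pi.neg_apply]
    linarith [H.jump_eq x hx]
  · rw [hl y ⟨hx.trans hxy, hy⟩, hr x ⟨hx, hxy.trans hy⟩]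
    have := H.abs_sub_le x y (-k) K hx hxy hy fun z hz => by
      rw [← abs_neg]
      convert hK z hz using 2
      simp; ring
    rw [← abs_neg] at this
    convert this using 2
    ring

lemma SMRepresents.apply_Ioo {ν : SignedMeasure ℝ} {f : ℝ → ℝ} {c d x y : ℝ}
    (H : SMRepresents ν f c d) (hf : HasOneSidedLims f (Ioo c d)) (hx : c < x) (hxy : x < y)
    (hy : y < d) : ν (Ioo x y) = leftLim f y - rightLim f x := by
  obtain ⟨z, hz, hzm, hzt⟩ := exists_seq_strictMono_tendsto' hxy
  have hU : (⋃ n, Ioc x (z n)) = Ioo x y := by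
    ext p
    simp only [mem_iUnion, mem_Ioc, mem_Ioo]
    refine ⟨fun ⟨n, h1, h2⟩ => ⟨h1, h2.trans_lt (hzm n).2⟩, fun ⟨h1, h2⟩ => ?_⟩
    obtain ⟨n, hn⟩ := (hzt.eventually (lt_mem_nhds h2)).exists
    exact ⟨n, h1, hn.le⟩
  have h1 := ν.tendsto_vectorMeasure_iUnion_atTop_nat (s := fun n => Ioc x (z n))
    (fun i j hij => Ioc_subset_Ioc_right (hz.monotone hij)) (fun _ => measurableSet_Ioc)
  rw [hU] at h1
  have h2 : Tendsto (fun n => rightLim f (z n) - rightLim f x) atTop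
      (𝓝 (leftLim f y - rightLim f x)) := by
    refine Tendsto.sub_const ?_ _
    refine (tendsto_rightLim_nhdsLT (hf y ⟨hx.trans hxy, hy⟩).1).comp
      (tendsto_nhdsWithin_iff.2 ⟨hzt, .of_forall fun n => (hzm n).2⟩)
  refine tendsto_nhds_unique h1 (h2.congr fun n => ?_)
  have := hzm n
  exact (H x ⟨hx.le, (hxy.trans hy).le⟩ (z n) ⟨(hx.trans this.1).le, (this.2.trans hy).le⟩
    this.1.le).symm

lemma SMRepresents.apply_singleton {ν : SignedMeasure ℝ} {f : ℝ → ℝ} {c d x : ℝ}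
    (H : SMRepresents ν f c d) (hf : HasOneSidedLims f (Ioo c d)) (hx : x ∈ Ioo c d) :
    ν {x} = rightLim f x - leftLim f x := by
  have hm : (c + x) / 2 ∈ Ioo c x := ⟨by linarith [hx.1], by linarith [hx.1]⟩
  have h1 := H.apply_Ioo hf hm.1 hm.2 hx.2
  have h2 := H _ ⟨hm.1.le, (hm.2.trans hx.2).le⟩ x ⟨hx.1.le, hx.2.le⟩ hm.2.le
  rw [← Ioo_union_right hm.2, VectorMeasure.of_union (by simp) measurableSet_Ioo
    (measurableSet_singleton x), h1] at h2
  linarith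

lemma sInt_singleton (ν : SignedMeasure ℝ) (h : ℝ → ℝ) (x : ℝ) :
    sInt ν h {x} = h x * ν {x} := by
  rw [sInt, ν.apply_eq_posPart_real_sub_negPart_real (measurableSet_singleton x)]
  simp only [Measure.restrict_singleton, integral_smul_measure, integral_dirac, measureReal_def,
    smul_eq_mul]
  ring

lemma abs_sInt_sub_le {ν : SignedMeasure ℝ} {h : ℝ → ℝ} {x y k K : ℝ}
    (hh : ∀ μ : Measure ℝ, AEMeasurable h (μ.restrict (Ioo x y)))
    (hK : ∀ z ∈ Ioo x y, |h z - k| ≤ K) :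
    |sInt ν h (Ioo x y) - k * ν (Ioo x y)| ≤ K * ν.totalVariation.real (Ioo x y) := by
  have key : ∀ (μ : Measure ℝ) [IsFiniteMeasure μ],
      |(∫ z in Ioo x y, h z ∂μ) - k * μ.real (Ioo x y)| ≤ K * μ.real (Ioo x y) := by
    intro μ _
    have hint : IntegrableOn h (Ioo x y) μ := by
      refine Integrable.of_bound (hh μ).aestronglyMeasurable (K + |k|) ?_
      filter_upwards [ae_restrict_mem measurableSet_Ioo] with z hz
      have := abs_add_le (h z - k) k
      rw [sub_add_cancel] at this
      rw [Real.norm_eq_abs]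
      linarith [hK z hz]
    have : (∫ z in Ioo x y, h z ∂μ) - k * μ.real (Ioo x y) = ∫ z in Ioo x y, (h z - k) ∂μ := by
      rw [integral_sub hint (integrable_const _)]
      simp [mul_comm]
    rw [this, ← Real.norm_eq_abs]
    exact norm_setIntegral_le_of_norm_le_const (measure_lt_top _ _) hK
  have h1 := key ν.toJordanDecomposition.posPart
  have h2 := key ν.toJordanDecomposition.negPart
  rw [sInt, ν.apply_eq_posPart_real_sub_negPart_real measurableSet_Ioo, SignedMeasure.totalVariation,
    measureReal_add_apply]
  rw [abs_le] at h1 h2 ⊢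
  constructor <;> linarith

lemma MeasureEqOn.exists_stieltjesEq {a b : EReal} {g h β : ℝ → ℝ} {c d : ℝ}
    (H : MeasureEqOn (EI a b) g (fun _ : Fin 1 => h) (fun _ => β))
    (hg : LocallyBoundedVariationOn g (EI a b)) (hh : LocallyBoundedVariationOn h (EI a b))
    (hβ : LocallyBoundedVariationOn β (EI a b)) (hc : c ∈ EI a b) (hd : d ∈ EI a b) (hcd : c < d) :
    ∃ M : Measure ℝ, IsFiniteMeasure M ∧ StieltjesEq M c d g h β := by
  obtain ⟨νg, ν, hνg, hν, hE⟩ := H c hc d hd hcd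
  have hsub : Ioo c d ⊆ EI a b := Ioo_subset_Icc_self.trans (Icc_subset_EI hc hd)
  have hgl := (hasOneSidedLims_of_locallyBoundedVariationOn hg).mono hsub
  have hβl := (hasOneSidedLims_of_locallyBoundedVariationOn hβ).mono hsub
  refine ⟨(ν 0).totalVariation, inferInstance, fun x hx => ?_, fun x y k K hx hxy hy hK => ?_⟩
  · have := hE {x} (by simpa using ⟨hx.1, hx.2.le⟩) (measurableSet_singleton x)
    rwa [Fin.sum_univ_one, sInt_singleton, hνg.apply_singleton hgl hx,
      (hν 0).apply_singleton hβl hx] at this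
  · have := hE (Ioo x y) (fun z hz => ⟨hx.trans hz.1, (hz.2.trans hy).le⟩) measurableSet_Ioo
    rw [Fin.sum_univ_one, hνg.apply_Ioo hgl hx hxy hy] at this
    rw [this, ← (hν 0).apply_Ioo hβl hx hxy hy]
    refine abs_sInt_sub_le (fun μ => ?_) hK
    obtain ⟨p, q, hp, hq, rfl⟩ := hh.exists_monotoneOn_sub_monotoneOn
    have hs : Ioo x y ⊆ EI a b :=
      fun z hz => hsub ⟨hx.trans hz.1, hz.2.trans hy⟩
    exact (aemeasurable_restrict_of_monotoneOn measurableSet_Ioo (hp.mono hs)).sub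
      (aemeasurable_restrict_of_monotoneOn measurableSet_Ioo (hq.mono hs))

lemma tendsto_measureReal_Ioo_nhdsGT (M : Measure ℝ) [IsFiniteMeasure M] (x : ℝ) :
    Tendsto (fun y => M.real (Ioo x y)) (𝓝[>] x) (𝓝 0) := by
  have h := tendsto_measure_biInter_gt (μ := M) (s := fun y => Ioo x y) (a := x)
    (fun _ _ => measurableSet_Ioo.nullMeasurableSet) (fun i j _ hij => Ioo_subset_Ioo_right hij)
    ⟨x + 1, by simp, measure_ne_top _ _⟩
  have he : (⋂ r > x, Ioo x r) = ∅ := by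
    refine eq_empty_of_forall_notMem fun z hz => ?_
    simp only [mem_iInter] at hz
    have h1 := hz (x + 1) (by simp)
    exact lt_irrefl z (hz z h1.1).2
  rw [he, measure_empty] at h
  have h2 := (ENNReal.tendsto_toReal ENNReal.zero_ne_top).comp h
  rw [ENNReal.toReal_zero] at h2
  exact h2

lemma tendsto_measureReal_Ioo_nhdsLT (M : Measure ℝ) [IsFiniteMeasure M] (x : ℝ) :
    Tendsto (fun y => M.real (Ioo y x)) (𝓝[<] x) (𝓝 0) := by
  have h := tendsto_measure_biInter_gt (ι := ℝᵒᵈ) (μ := M)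
    (s := fun y => Ioo (OrderDual.ofDual y) x) (a := OrderDual.toDual x)
    (fun _ _ => measurableSet_Ioo.nullMeasurableSet) (fun i j _ hij => Ioo_subset_Ioo_left hij)
    ⟨OrderDual.toDual (x - 1), sub_one_lt x, measure_ne_top _ _⟩
  have he : (⋂ r > OrderDual.toDual x, Ioo (OrderDual.ofDual r) x) = ∅ := by
    refine eq_empty_of_forall_notMem fun z hz => ?_
    simp only [mem_iInter] at hz
    have h1 := hz (OrderDual.toDual (x - 1)) (sub_one_lt x)
    exact lt_irrefl z (hz (OrderDual.toDual z) h1.2).1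
  rw [he, measure_empty] at h
  have h2 := (ENNReal.tendsto_toReal ENNReal.zero_ne_top).comp h
  rw [ENNReal.toReal_zero] at h2
  exact h2

/-- A function given by its left limits `Fl` and right limits `Fr` is nondecreasing if its jumps are
nonnegative and its increments are locally bounded below by `-ε M` for every `ε > 0`. -/
lemma le_of_local_increments {M : Measure ℝ} [IsFiniteMeasure M] {Fl Fr : ℝ → ℝ} {s t : ℝ}
    (hst : s < t) (hjump : ∀ x ∈ Ioo s t, Fl x ≤ Fr x)
    (hright : ∀ x ∈ Ico s t, ∀ ε > 0, ∀ᶠ y in 𝓝[>] x, -(ε * M.real (Ioo x y)) ≤ Fl y - Fr x)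
    (hleft : ∀ x ∈ Ioc s t, ∀ ε > 0, ∀ᶠ y in 𝓝[<] x, -(ε * M.real (Ioo y x)) ≤ Fl x - Fr y) :
    Fr s ≤ Fl t := by
  have key : ∀ ε > 0, -(ε * M.real (Ioo s t)) ≤ Fl t - Fr s := by
    intro ε hε
    have hadd : ∀ x y, s < x → x < y →
        ε * M.real (Ioo s x) + ε * M.real (Ioo x y) ≤ ε * M.real (Ioo s y) := by
      intro x y hx hy
      rw [← mul_add, ← measureReal_union _ measurableSet_Ioo]
      · gcongr
        · exact measure_ne_top _ _
        · exact union_subset (Ioo_subset_Ioo_right hy.le) (Ioo_subset_Ioo_left hx.le)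
      · exact Set.disjoint_left.2 fun z h1 h2 => lt_asymm h1.2 h2.1
    set T : Set ℝ := {y | y ∈ Ioc s t ∧ -(ε * M.real (Ioo s y)) ≤ Fl y - Fr s} with hT
    have hne : T.Nonempty := by
      obtain ⟨y, h1, h2⟩ := ((hright s ⟨le_rfl, hst⟩ ε hε).and (Ioo_mem_nhdsGT hst)).exists
      exact ⟨y, ⟨h2.1, h2.2.le⟩, h1⟩
    have hbdd : BddAbove T := ⟨t, fun y hy => hy.1.2⟩
    set p := sSup T with hp
    obtain ⟨y₀, hy₀⟩ := hne
    have hsp : s < p := hy₀.1.1.trans_le (le_csSup hbdd hy₀)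
    have hpt : p ≤ t := csSup_le ⟨y₀, hy₀⟩ fun y hy => hy.1.2
    have hpT : p ∈ T := by
      obtain ⟨l, hl, hl'⟩ := mem_nhdsLT_iff_exists_Ioo_subset.1 (hleft p ⟨hsp, hpt⟩ ε hε)
      obtain ⟨y, hyT, hly⟩ := exists_lt_of_lt_csSup ⟨y₀, hy₀⟩ hl
      rcases (le_csSup hbdd hyT).lt_or_eq with h | h
      · have h1 := hl' ⟨hly, h⟩
        have h2 := hjump y ⟨hyT.1.1, h.trans_le hpt⟩
        have h3 := hadd y p hyT.1.1 h
        refine ⟨⟨hsp, hpt⟩, ?_⟩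
        have h4 := hyT.2
        replace h1 : -(ε * M.real (Ioo y p)) ≤ Fl p - Fr y := h1
        linarith
      · rwa [h] at hyT
    rcases hpt.lt_or_eq with h | h
    · obtain ⟨y, h1, h2⟩ := ((hright p ⟨hsp.le, h⟩ ε hε).and (Ioo_mem_nhdsGT h)).exists
      have h3 := hjump p ⟨hsp, h⟩
      have h4 := hadd p y hsp h2.1
      have : y ∈ T := ⟨⟨hsp.trans h2.1, h2.2.le⟩, by linarith [hpT.2]⟩
      exact absurd (le_csSup hbdd this) (not_le.2 h2.1)
    · exact h ▸ hpT.2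
  rw [← sub_nonneg]
  refine le_of_forall_pos_le_add fun ε hε => ?_
  have h0 : 0 ≤ M.real (Ioo s t) := measureReal_nonneg
  have h1 := key (ε / (M.real (Ioo s t) + 1)) (by positivity)
  have h2 : ε / (M.real (Ioo s t) + 1) * M.real (Ioo s t) ≤ ε := by
    rw [div_mul_eq_mul_div, div_le_iff₀ (by positivity)]
    nlinarith
  linarith

namespace StieltjesEq

variable {M : Measure ℝ} {c d : ℝ} {g h β : ℝ → ℝ}

lemma eventually_right (H : StieltjesEq M c d g h β) {x l ε : ℝ} (hx : x ∈ Ioo c d)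
    (hl : Tendsto h (𝓝[>] x) (𝓝 l)) (hε : 0 < ε) : ∀ᶠ y in 𝓝[>] x,
      |leftLim g y - rightLim g x - l * (leftLim β y - rightLim β x)| ≤ ε * M.real (Ioo x y) := by
  obtain ⟨p, hp, hp'⟩ := mem_nhdsGT_iff_exists_Ioo_subset.1 (hl (Metric.closedBall_mem_nhds l hε))
  filter_upwards [Ioo_mem_nhdsGT hx.2, Ioo_mem_nhdsGT hp] with y hy hyp
  exact H.abs_sub_le x y l ε hx.1 hy.1 hy.2 fun z hz => hp' ⟨hz.1, hz.2.trans hyp.2⟩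

lemma eventually_left (H : StieltjesEq M c d g h β) {x l ε : ℝ} (hx : x ∈ Ioo c d)
    (hl : Tendsto h (𝓝[<] x) (𝓝 l)) (hε : 0 < ε) : ∀ᶠ y in 𝓝[<] x,
      |leftLim g x - rightLim g y - l * (leftLim β x - rightLim β y)| ≤ ε * M.real (Ioo y x) := by
  obtain ⟨p, hp, hp'⟩ := mem_nhdsLT_iff_exists_Ioo_subset.1 (hl (Metric.closedBall_mem_nhds l hε))
  filter_upwards [Ioo_mem_nhdsLT hx.1, Ioo_mem_nhdsLT hp] with y hy hyp
  exact H.abs_sub_le y x l ε hy.1 hy.2 hx.2 fun z hz => hp' ⟨hyp.1.trans hz.1, hz.2⟩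

lemma eventually_right_mul (H : StieltjesEq M c d g h β) {x l ε : ℝ} {f : ℝ → ℝ}
    (hx : x ∈ Ioo c d) (hl : Tendsto h (𝓝[>] x) (𝓝 l)) (hf : Tendsto f (𝓝[>] x) (𝓝 0))
    (hε : 0 < ε) : ∀ᶠ y in 𝓝[>] x,
      |(leftLim g y - rightLim g x) * f y| ≤ ε * M.real (Ioo x y) := by
  obtain ⟨p, hp, hp'⟩ := mem_nhdsGT_iff_exists_Ioo_subset.1 (hl (Metric.closedBall_mem_nhds l one_pos))
  have hK : 0 < |l| + 1 := by positivity
  filter_upwards [Ioo_mem_nhdsGT hx.2, Ioo_mem_nhdsGT hp,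
    hf (Metric.closedBall_mem_nhds 0 (div_pos hε hK))] with y hy hyp hfy
  have h1 := H.abs_sub_le x y 0 (|l| + 1) hx.1 hy.1 hy.2 fun z hz => by
    have h2 : |h z - l| ≤ 1 := hp' ⟨hz.1, hz.2.trans hyp.2⟩
    have := abs_add_le (h z - l) l
    rw [sub_add_cancel] at this
    rw [sub_zero]
    linarith
  rw [zero_mul, sub_zero] at h1
  have h2 : |f y| ≤ ε / (|l| + 1) := by simpa using hfy
  rw [abs_mul]
  calc _ ≤ (|l| + 1) * M.real (Ioo x y) * (ε / (|l| + 1)) := by gcongr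
    _ = ε * M.real (Ioo x y) := by field_simp

lemma eventually_left_mul (H : StieltjesEq M c d g h β) {x l ε : ℝ} {f : ℝ → ℝ}
    (hx : x ∈ Ioo c d) (hl : Tendsto h (𝓝[<] x) (𝓝 l)) (hf : Tendsto f (𝓝[<] x) (𝓝 0))
    (hε : 0 < ε) : ∀ᶠ y in 𝓝[<] x,
      |(leftLim g x - rightLim g y) * f y| ≤ ε * M.real (Ioo y x) := by
  obtain ⟨p, hp, hp'⟩ := mem_nhdsLT_iff_exists_Ioo_subset.1 (hl (Metric.closedBall_mem_nhds l one_pos))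
  have hK : 0 < |l| + 1 := by positivity
  filter_upwards [Ioo_mem_nhdsLT hx.1, Ioo_mem_nhdsLT hp,
    hf (Metric.closedBall_mem_nhds 0 (div_pos hε hK))] with y hy hyp hfy
  have h1 := H.abs_sub_le y x 0 (|l| + 1) hy.1 hy.2 hx.2 fun z hz => by
    have h2 : |h z - l| ≤ 1 := hp' ⟨hyp.1.trans hz.1, hz.2⟩
    have := abs_add_le (h z - l) l
    rw [sub_add_cancel] at this
    rw [sub_zero]
    linarith
  rw [zero_mul, sub_zero] at h1
  have h2 : |f y| ≤ ε / (|l| + 1) := by simpa using hfy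
  rw [abs_mul]
  calc _ ≤ (|l| + 1) * M.real (Ioo y x) * (ε / (|l| + 1)) := by gcongr
    _ = ε * M.real (Ioo y x) := by field_simp

lemma mul_increment_le [IsFiniteMeasure M] (H : StieltjesEq M c d g h β)
    (hh : HasOneSidedLims h (Ioo c d))
    (hβ : ∀ x ∈ Ioo c d, leftLim β x ≤ rightLim β x)
    (hβ' : ∀ x ∈ Ioo c d, ∀ y ∈ Ioo c d, x < y → rightLim β x ≤ leftLim β y)
    {x y k : ℝ} (hx : c < x) (hxy : x < y) (hy : y < d) (hk : ∀ z ∈ Ioo x y, k ≤ h z) :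
    k * (leftLim β y - rightLim β x) ≤ leftLim g y - rightLim g x := by
  have hsub : ∀ p ∈ Icc x y, p ∈ Ioo c d := fun p hp => ⟨hx.trans_le hp.1, hp.2.trans_lt hy⟩
  have := le_of_local_increments (M := M) (Fl := fun z => leftLim g z - k * leftLim β z)
    (Fr := fun z => rightLim g z - k * rightLim β z) hxy ?_ ?_ ?_
  · linarith
  · intro p hp
    have hp' := hsub p (Ioo_subset_Icc_self hp)
    have h1 := H.jump_eq p hp'
    have := mul_nonneg (sub_nonneg.2 (hk p hp)) (sub_nonneg.2 (hβ p hp'))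
    linarith
  · intro p hp ε hε
    have hp' := hsub p (Ico_subset_Icc_self hp)
    have hl := (hh p hp').2
    have hkl : k ≤ rightLim h p := ge_of_tendsto hl <| by
      filter_upwards [Ioo_mem_nhdsGT hp.2] with z hz using hk z ⟨hp.1.trans_lt hz.1, hz.2⟩
    filter_upwards [H.eventually_right hp' hl hε, Ioo_mem_nhdsGT hp.2] with z hz hpz
    have h2 := mul_nonneg (sub_nonneg.2 hkl)
      (sub_nonneg.2 (hβ' p hp' z (hsub z ⟨hp.1.trans hpz.1.le, hpz.2.le⟩) hpz.1))
    have h3 := (abs_le.1 hz).1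
    linarith
  · intro p hp ε hε
    have hp' := hsub p (Ioc_subset_Icc_self hp)
    have hl := (hh p hp').1
    have hkl : k ≤ leftLim h p := ge_of_tendsto hl <| by
      filter_upwards [Ioo_mem_nhdsLT hp.1] with z hz using hk z ⟨hz.1, hz.2.trans_le hp.2⟩
    filter_upwards [H.eventually_left hp' hl hε, Ioo_mem_nhdsLT hp.1] with z hz hpz
    have h2 := mul_nonneg (sub_nonneg.2 hkl)
      (sub_nonneg.2 (hβ' z (hsub z ⟨hpz.1.le, hpz.2.le.trans hp.2⟩) p hp' hpz.2))
    have h3 := (abs_le.1 hz).1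
    linarith

lemma abs_le_half_of_right (H : StieltjesEq M c d g h β) [IsFiniteMeasure M]
    (hg : HasOneSidedLims g (Ioo c d))
    (hbal : ∀ x ∈ Ioo c d, g x = (leftLim g x + rightLim g x) / 2) {x y C : ℝ} (hx : c < x)
    (hy : y < d) (h0 : rightLim g x = 0) (hM : M.real (Ioo x y) ≤ 1 / 2)
    (hC : ∀ z ∈ Ioo x y, |h z| ≤ C) : ∀ z ∈ Ioo x y, |g z| ≤ C / 2 := by
  have hl : ∀ z ∈ Ioo x y, |leftLim g z| ≤ C / 2 := by
    intro z hz
    have hC0 : 0 ≤ C := (abs_nonneg _).trans (hC z hz)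
    have h1 := H.abs_sub_le x z 0 C hx hz.1 (hz.2.trans hy) fun p hp => by
      simpa using hC p ⟨hp.1, hp.2.trans hz.2⟩
    rw [h0, zero_mul, sub_zero, sub_zero] at h1
    have h2 : M.real (Ioo x z) ≤ 1 / 2 :=
      (measureReal_mono (Ioo_subset_Ioo_right hz.2.le)).trans hM
    nlinarith
  intro z hz
  have hz' : z ∈ Ioo c d := ⟨hx.trans hz.1, hz.2.trans hy⟩
  have hr : |rightLim g z| ≤ C / 2 := by
    refine le_of_tendsto (tendsto_leftLim_nhdsGT (hg z hz').2).abs ?_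
    filter_upwards [Ioo_mem_nhdsGT hz.2] with p hp using hl p ⟨hz.1.trans hp.1, hp.2⟩
  have h1 := abs_le.1 hr
  have h2 := abs_le.1 (hl z hz)
  rw [hbal z hz', abs_le]
  constructor <;> linarith

lemma abs_le_half_of_left (H : StieltjesEq M c d g h β) [IsFiniteMeasure M]
    (hg : HasOneSidedLims g (Ioo c d))
    (hbal : ∀ x ∈ Ioo c d, g x = (leftLim g x + rightLim g x) / 2) {x y C : ℝ} (hy : c < y)
    (hx : x < d) (h0 : leftLim g x = 0) (hM : M.real (Ioo y x) ≤ 1 / 2)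
    (hC : ∀ z ∈ Ioo y x, |h z| ≤ C) : ∀ z ∈ Ioo y x, |g z| ≤ C / 2 := by
  have hr : ∀ z ∈ Ioo y x, |rightLim g z| ≤ C / 2 := by
    intro z hz
    have hC0 : 0 ≤ C := (abs_nonneg _).trans (hC z hz)
    have h1 := H.abs_sub_le z x 0 C (hy.trans hz.1) hz.2 hx fun p hp => by
      simpa using hC p ⟨hz.1.trans hp.1, hp.2⟩
    rw [h0, zero_mul, sub_zero, zero_sub, abs_neg] at h1
    have h2 : M.real (Ioo z x) ≤ 1 / 2 :=
      (measureReal_mono (Ioo_subset_Ioo_left hz.1.le)).trans hM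
    nlinarith
  intro z hz
  have hz' : z ∈ Ioo c d := ⟨hy.trans hz.1, hz.2.trans hx⟩
  have hl : |leftLim g z| ≤ C / 2 := by
    refine le_of_tendsto (tendsto_rightLim_nhdsLT (hg z hz').1).abs ?_
    filter_upwards [Ioo_mem_nhdsLT hz.1] with p hp using hr p ⟨hp.1, hp.2.trans hz.2⟩
  have h1 := abs_le.1 hl
  have h2 := abs_le.1 (hr z hz)
  rw [hbal z hz', abs_le]
  constructor <;> linarith

end StieltjesEq

/-- The pair `(u,w)` is a balanced solution on `(c,d)` of `du = w dα`, `dw = u dβ`, with the measure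
equations recorded through the estimates of `StieltjesEq`. -/
structure LocalSolution (M : Measure ℝ) (c d : ℝ) (α β u w : ℝ → ℝ) : Prop where
  lims_fst : HasOneSidedLims u (Ioo c d)
  lims_snd : HasOneSidedLims w (Ioo c d)
  bal_fst : ∀ x ∈ Ioo c d, u x = (leftLim u x + rightLim u x) / 2
  bal_snd : ∀ x ∈ Ioo c d, w x = (leftLim w x + rightLim w x) / 2
  eq_fst : StieltjesEq M c d u w α
  eq_snd : StieltjesEq M c d w u β

/-- The one-sided limits of a strictly increasing function. -/
structure IncreasingLims (c d : ℝ) (α : ℝ → ℝ) : Prop where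
  left_le_right : ∀ x ∈ Ioo c d, leftLim α x ≤ rightLim α x
  right_lt_left : ∀ x ∈ Ioo c d, ∀ y ∈ Ioo c d, x < y → rightLim α x < leftLim α y

lemma IncreasingLims.of_strictMonoOn {c d : ℝ} {α : ℝ → ℝ} (hα : StrictMonoOn α (Ioo c d))
    (hl : HasOneSidedLims α (Ioo c d)) : IncreasingLims c d α := by
  refine ⟨fun x hx => ?_, fun x hx y hy hxy => ?_⟩
  · refine (le_of_tendsto (hl x hx).1 (b := α x) ?_).trans (ge_of_tendsto (hl x hx).2 ?_)
    · filter_upwards [Ioo_mem_nhdsLT hx.1] with z hz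
        using (hα ⟨hz.1, hz.2.trans hx.2⟩ hx hz.2).le
    · filter_upwards [Ioo_mem_nhdsGT hx.2] with z hz
        using (hα hx ⟨hx.1.trans hz.1, hz.2⟩ hz.1).le
  · obtain ⟨p, hxp, hpy⟩ := exists_between hxy
    obtain ⟨q, hpq, hqy⟩ := exists_between hpy
    have hp : p ∈ Ioo c d := ⟨hx.1.trans hxp, hpy.trans hy.2⟩
    have hq : q ∈ Ioo c d := ⟨hp.1.trans hpq, hqy.trans hy.2⟩
    refine (le_of_tendsto (hl x hx).2 (b := α p) ?_).trans_lt
      ((hα hp hq hpq).trans_le (ge_of_tendsto (hl y hy).1 ?_))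
    · filter_upwards [Ioo_mem_nhdsGT hxp] with z hz
        using (hα ⟨hx.1.trans hz.1, hz.2.trans hp.2⟩ hp hz.2).le
    · filter_upwards [Ioo_mem_nhdsLT hqy] with z hz
        using (hα hq ⟨hq.1.trans hz.1, hz.2.trans hy.2⟩ hz.1).le

namespace LocalSolution

variable {M : Measure ℝ} {c d : ℝ} {α β u w : ℝ → ℝ}

lemma leftLim_neg_fst (H : LocalSolution M c d α β u w) {x : ℝ} (hx : x ∈ Ioo c d) :
    leftLim (-u) x = -leftLim u x := leftLim_eq_of_tendsto (H.lims_fst x hx).1.neg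

lemma rightLim_neg_fst (H : LocalSolution M c d α β u w) {x : ℝ} (hx : x ∈ Ioo c d) :
    rightLim (-u) x = -rightLim u x := rightLim_eq_of_tendsto (H.lims_fst x hx).2.neg

lemma leftLim_neg_snd (H : LocalSolution M c d α β u w) {x : ℝ} (hx : x ∈ Ioo c d) :
    leftLim (-w) x = -leftLim w x := leftLim_eq_of_tendsto (H.lims_snd x hx).1.neg

lemma rightLim_neg_snd (H : LocalSolution M c d α β u w) {x : ℝ} (hx : x ∈ Ioo c d) :
    rightLim (-w) x = -rightLim w x := rightLim_eq_of_tendsto (H.lims_snd x hx).2.neg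

lemma neg (H : LocalSolution M c d α β u w) : LocalSolution M c d α β (-u) (-w) where
  lims_fst x hx := by
    rw [H.leftLim_neg_fst hx, H.rightLim_neg_fst hx]
    exact ⟨(H.lims_fst x hx).1.neg, (H.lims_fst x hx).2.neg⟩
  lims_snd x hx := by
    rw [H.leftLim_neg_snd hx, H.rightLim_neg_snd hx]
    exact ⟨(H.lims_snd x hx).1.neg, (H.lims_snd x hx).2.neg⟩
  bal_fst x hx := by
    rw [H.leftLim_neg_fst hx, H.rightLim_neg_fst hx, Pi.neg_apply, H.bal_fst x hx]
    ring
  bal_snd x hx := by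
    rw [H.leftLim_neg_snd hx, H.rightLim_neg_snd hx, Pi.neg_apply, H.bal_snd x hx]
    ring
  eq_fst := H.eq_fst.neg H.lims_fst
  eq_snd := H.eq_snd.neg H.lims_snd

lemma left_eq_zero_iff_right_eq_zero (H : LocalSolution M c d α β u w) {x : ℝ} (hx : x ∈ Ioo c d)
    (hω : omegaFn α β x ≠ 0) :
    (leftLim u x = 0 ∧ leftLim w x = 0) ↔ (rightLim u x = 0 ∧ rightLim w x = 0) := by
  have h1 := H.eq_fst.jump_eq x hx
  have h2 := H.eq_snd.jump_eq x hx
  rw [H.bal_snd x hx] at h1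
  rw [H.bal_fst x hx] at h2
  rw [omegaFn, jump, jump] at hω
  set A := rightLim α x - leftLim α x
  set B := rightLim β x - leftLim β x
  constructor
  · rintro ⟨h3, h4⟩
    rw [h3, h4] at h1 h2
    have h5 : rightLim u x * (1 - A * B / 4) = 0 := by linear_combination h1 + A / 2 * h2
    have h6 := (mul_eq_zero.1 h5).resolve_right hω
    rw [h6] at h2
    exact ⟨h6, by linarith⟩
  · rintro ⟨h3, h4⟩
    rw [h3, h4] at h1 h2
    have h5 : leftLim u x * (1 - A * B / 4) = 0 := by linear_combination -h1 + A / 2 * h2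
    have h6 := (mul_eq_zero.1 h5).resolve_right hω
    rw [h6] at h2
    exact ⟨h6, by linarith⟩

lemma eventually_eq_zero_right [IsFiniteMeasure M] (H : LocalSolution M c d α β u w) {x : ℝ}
    (hx : x ∈ Ioo c d) (hu : rightLim u x = 0) (hw : rightLim w x = 0) :
    ∀ᶠ y in 𝓝[>] x, u y = 0 ∧ w y = 0 := by
  have hu1 := (H.lims_fst x hx).2
  have hw1 := (H.lims_snd x hx).2
  rw [hu] at hu1
  rw [hw] at hw1
  obtain ⟨p, hp, hp'⟩ := mem_nhdsGT_iff_exists_Ioo_subset.1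
    (inter_mem (hu1 (Metric.closedBall_mem_nhds 0 one_pos))
      (hw1 (Metric.closedBall_mem_nhds 0 one_pos)))
  obtain ⟨y, ⟨hyM, hyp⟩, hyd⟩ := ((((tendsto_measureReal_Ioo_nhdsGT M x).eventually_le_const
    (show (0 : ℝ) < 1 / 2 by norm_num)).and (Ioo_mem_nhdsGT hp)).and (Ioo_mem_nhdsGT hx.2)).exists
  have key : ∀ n : ℕ, ∀ z ∈ Ioo x y, |u z| ≤ (1 / 2) ^ n ∧ |w z| ≤ (1 / 2) ^ n := by
    intro n
    induction n with
    | zero =>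
      intro z hz
      have := hp' ⟨hz.1, hz.2.trans hyp.2⟩
      simpa using this
    | succ n ih =>
      intro z hz
      rw [pow_succ, mul_one_div]
      exact ⟨H.eq_fst.abs_le_half_of_right H.lims_fst H.bal_fst hx.1 hyd.2 hu hyM
          (fun q hq => (ih q hq).2) z hz,
        H.eq_snd.abs_le_half_of_right H.lims_snd H.bal_snd hx.1 hyd.2 hw hyM
          (fun q hq => (ih q hq).1) z hz⟩
  have hlim : Tendsto (fun n : ℕ => (1 / 2 : ℝ) ^ n) atTop (𝓝 0) :=
    tendsto_pow_atTop_nhds_zero_of_lt_one (by norm_num) (by norm_num)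
  filter_upwards [Ioo_mem_nhdsGT hyd.1] with z hz
  exact ⟨abs_nonpos_iff.1 (ge_of_tendsto' hlim fun n => (key n z hz).1),
    abs_nonpos_iff.1 (ge_of_tendsto' hlim fun n => (key n z hz).2)⟩

lemma eventually_eq_zero_left [IsFiniteMeasure M] (H : LocalSolution M c d α β u w) {x : ℝ}
    (hx : x ∈ Ioo c d) (hu : leftLim u x = 0) (hw : leftLim w x = 0) :
    ∀ᶠ y in 𝓝[<] x, u y = 0 ∧ w y = 0 := by
  have hu1 := (H.lims_fst x hx).1
  have hw1 := (H.lims_snd x hx).1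
  rw [hu] at hu1
  rw [hw] at hw1
  obtain ⟨p, hp, hp'⟩ := mem_nhdsLT_iff_exists_Ioo_subset.1
    (inter_mem (hu1 (Metric.closedBall_mem_nhds 0 one_pos))
      (hw1 (Metric.closedBall_mem_nhds 0 one_pos)))
  obtain ⟨y, ⟨hyM, hyp⟩, hyd⟩ := ((((tendsto_measureReal_Ioo_nhdsLT M x).eventually_le_const
    (show (0 : ℝ) < 1 / 2 by norm_num)).and (Ioo_mem_nhdsLT hp)).and (Ioo_mem_nhdsLT hx.1)).exists
  have key : ∀ n : ℕ, ∀ z ∈ Ioo y x, |u z| ≤ (1 / 2) ^ n ∧ |w z| ≤ (1 / 2) ^ n := by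
    intro n
    induction n with
    | zero =>
      intro z hz
      have := hp' ⟨hyp.1.trans hz.1, hz.2⟩
      simpa using this
    | succ n ih =>
      intro z hz
      rw [pow_succ, mul_one_div]
      exact ⟨H.eq_fst.abs_le_half_of_left H.lims_fst H.bal_fst hyd.1 hx.2 hu hyM
          (fun q hq => (ih q hq).2) z hz,
        H.eq_snd.abs_le_half_of_left H.lims_snd H.bal_snd hyd.1 hx.2 hw hyM
          (fun q hq => (ih q hq).1) z hz⟩
  have hlim : Tendsto (fun n : ℕ => (1 / 2 : ℝ) ^ n) atTop (𝓝 0) :=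
    tendsto_pow_atTop_nhds_zero_of_lt_one (by norm_num) (by norm_num)
  filter_upwards [Ioo_mem_nhdsLT hyd.2] with z hz
  exact ⟨abs_nonpos_iff.1 (ge_of_tendsto' hlim fun n => (key n z hz).1),
    abs_nonpos_iff.1 (ge_of_tendsto' hlim fun n => (key n z hz).2)⟩

/-- A solution that does not vanish at some point has nonzero left-hand data everywhere. -/
lemma left_ne_zero [IsFiniteMeasure M] (H : LocalSolution M c d α β u w)
    (hω : ∀ x ∈ Ioo c d, omegaFn α β x ≠ 0) {x₀ : ℝ} (hx₀ : x₀ ∈ Ioo c d) (hu : u x₀ ≠ 0) {x : ℝ}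
    (hx : x ∈ Ioo c d) : ¬ (leftLim u x = 0 ∧ leftLim w x = 0) := by
  intro hzero
  set P : ℝ → Prop := fun x => leftLim u x = 0 ∧ leftLim w x = 0 with hP
  have hloc : ∀ y ∈ Ioo c d, ∀ᶠ z in 𝓝[Ioo c d] y, P y ↔ P z := by
    intro y hy
    refine nhdsWithin_le_nhds ?_
    suffices h : (∀ᶠ z in 𝓝[<] y, P y ↔ P z) ∧ ∀ᶠ z in 𝓝[>] y, P y ↔ P z by
      have := eventually_sup.2 h
      rw [nhdsLT_sup_nhdsGT, eventually_nhdsWithin_iff] at this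
      filter_upwards [this] with z hz
      by_cases h : z = y
      · rw [h]
      · exact hz h
    by_cases hPy : P y
    · have hPr := (H.left_eq_zero_iff_right_eq_zero hy (hω y hy)).1 hPy
      have hzl : ∀ {f : ℝ → ℝ} {z : ℝ}, (∀ᶠ q in 𝓝 z, f q = 0) → leftLim f z = 0 := by
        intro f z hf
        exact leftLim_eq_of_tendsto (tendsto_const_nhds.congr' <| by
          filter_upwards [nhdsWithin_le_nhds hf] with q hq using hq.symm)
      constructor
      · have h1 := H.eventually_eq_zero_left hy hPy.1 hPy.2
        obtain ⟨p, hp, hp'⟩ := mem_nhdsLT_iff_exists_Ioo_subset.1 h1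
        filter_upwards [Ioo_mem_nhdsLT hp] with z hz
        refine iff_of_true hPy ⟨hzl ?_, hzl ?_⟩ <;>
          filter_upwards [Ioo_mem_nhds hz.1 hz.2] with q hq
        exacts [(hp' hq).1, (hp' hq).2]
      · have h1 := H.eventually_eq_zero_right hy hPr.1 hPr.2
        obtain ⟨p, hp, hp'⟩ := mem_nhdsGT_iff_exists_Ioo_subset.1 h1
        filter_upwards [Ioo_mem_nhdsGT hp] with z hz
        refine iff_of_true hPy ⟨hzl ?_, hzl ?_⟩ <;>
          filter_upwards [Ioo_mem_nhds hz.1 hz.2] with q hq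
        exacts [(hp' hq).1, (hp' hq).2]
    · have hPr := mt (H.left_eq_zero_iff_right_eq_zero hy (hω y hy)).2 hPy
      constructor
      · have h1 := tendsto_leftLim_nhdsLT (H.lims_fst y hy).1
        have h2 := tendsto_leftLim_nhdsLT (H.lims_snd y hy).1
        rcases not_and_or.1 hPy with h | h
        · filter_upwards [h1.eventually_ne h] with z hz using iff_of_false hPy fun hh => hz hh.1
        · filter_upwards [h2.eventually_ne h] with z hz using iff_of_false hPy fun hh => hz hh.2
      · have h1 := tendsto_leftLim_nhdsGT (H.lims_fst y hy).2
        have h2 := tendsto_leftLim_nhdsGT (H.lims_snd y hy).2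
        rcases not_and_or.1 hPr with h | h
        · filter_upwards [h1.eventually_ne h] with z hz using iff_of_false hPy fun hh => hz hh.1
        · filter_upwards [h2.eventually_ne h] with z hz using iff_of_false hPy fun hh => hz hh.2
  have hP₀ : P x₀ := (isPreconnected_Ioo.induction₂ (fun y z => P y ↔ P z) hloc
    (fun _ _ _ _ _ _ h1 h2 => h1.trans h2) (fun _ _ _ _ h => h.symm) hx hx₀).1 hzero
  have hr := (H.left_eq_zero_iff_right_eq_zero hx₀ (hω x₀ hx₀)).1 hP₀
  exact hu (by rw [H.bal_fst x₀ hx₀, hP₀.1, hr.1]; norm_num)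

lemma eventually_pos_right [IsFiniteMeasure M] (H : LocalSolution M c d α β u w)
    (hα : IncreasingLims c d α) {x : ℝ} (hx : x ∈ Ioo c d)
    (h : 0 < rightLim u x ∨ rightLim u x = 0 ∧ 0 < rightLim w x) :
    ∀ᶠ y in 𝓝[>] x, 0 < leftLim u y ∧ 0 < rightLim u y := by
  rcases h with h | ⟨h0, h⟩
  · exact ((tendsto_leftLim_nhdsGT (H.lims_fst x hx).2).eventually_const_lt h).and
      ((tendsto_rightLim_nhdsGT (H.lims_fst x hx).2).eventually_const_lt h)
  · obtain ⟨k, hk, hkw⟩ := exists_between h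
    obtain ⟨p, hp, hp'⟩ := mem_nhdsGT_iff_exists_Ioo_subset.1
      ((H.lims_snd x hx).2.eventually_const_lt hkw)
    filter_upwards [Ioo_mem_nhdsGT hp, Ioo_mem_nhdsGT hx.2] with y hyp hyd
    have hy : y ∈ Ioo c d := ⟨hx.1.trans hyd.1, hyd.2⟩
    have h1 := H.eq_fst.mul_increment_le H.lims_snd hα.left_le_right
      (fun p hp q hq hpq => (hα.right_lt_left p hp q hq hpq).le) hx.1 hyd.1 hyd.2
      (k := k) fun z hz => (hp' ⟨hz.1, hz.2.trans hyp.2⟩).le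
    have h2 := mul_pos hk (sub_pos.2 (hα.right_lt_left x hx y hy hyd.1))
    have h3 := H.eq_fst.jump_eq y hy
    have h4 := mul_nonneg (hk.trans (hp' hyp)).le (sub_nonneg.2 (hα.left_le_right y hy))
    constructor <;> linarith

lemma eventually_neg_left [IsFiniteMeasure M] (H : LocalSolution M c d α β u w)
    (hα : IncreasingLims c d α) {x : ℝ} (hx : x ∈ Ioo c d)
    (h : leftLim u x < 0 ∨ leftLim u x = 0 ∧ 0 < leftLim w x) :
    ∀ᶠ y in 𝓝[<] x, leftLim u y < 0 ∧ rightLim u y < 0 := by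
  rcases h with h | ⟨h0, h⟩
  · exact ((tendsto_leftLim_nhdsLT (H.lims_fst x hx).1).eventually_lt_const h).and
      ((tendsto_rightLim_nhdsLT (H.lims_fst x hx).1).eventually_lt_const h)
  · obtain ⟨k, hk, hkw⟩ := exists_between h
    obtain ⟨p, hp, hp'⟩ := mem_nhdsLT_iff_exists_Ioo_subset.1
      ((H.lims_snd x hx).1.eventually_const_lt hkw)
    filter_upwards [Ioo_mem_nhdsLT hp, Ioo_mem_nhdsLT hx.1] with y hyp hyd
    have hy : y ∈ Ioo c d := ⟨hyd.1, hyd.2.trans hx.2⟩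
    have h1 := H.eq_fst.mul_increment_le H.lims_snd hα.left_le_right
      (fun p hp q hq hpq => (hα.right_lt_left p hp q hq hpq).le) hyd.1 hyd.2 hx.2
      (k := k) fun z hz => (hp' ⟨hyp.1.trans hz.1, hz.2⟩).le
    have h2 := mul_pos hk (sub_pos.2 (hα.right_lt_left y hy x hx hyd.2))
    have h3 := H.eq_fst.jump_eq y hy
    have h4 := mul_nonneg (hk.trans (hp' hyp)).le (sub_nonneg.2 (hα.left_le_right y hy))
    constructor <;> linarith

lemma eventually_neg_right [IsFiniteMeasure M] (H : LocalSolution M c d α β u w)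
    (hα : IncreasingLims c d α) {x : ℝ} (hx : x ∈ Ioo c d)
    (h : rightLim u x < 0 ∨ rightLim u x = 0 ∧ rightLim w x < 0) :
    ∀ᶠ y in 𝓝[>] x, leftLim u y < 0 ∧ rightLim u y < 0 := by
  have h1 := H.neg.eventually_pos_right hα hx (by
    rw [H.rightLim_neg_fst hx, H.rightLim_neg_snd hx]
    simpa using h)
  filter_upwards [h1, Ioo_mem_nhdsGT hx.2] with y hy hyd
  have hyc : y ∈ Ioo c d := ⟨hx.1.trans hyd.1, hyd.2⟩
  simpa [H.leftLim_neg_fst hyc, H.rightLim_neg_fst hyc] using hy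

lemma eventually_pos_left [IsFiniteMeasure M] (H : LocalSolution M c d α β u w)
    (hα : IncreasingLims c d α) {x : ℝ} (hx : x ∈ Ioo c d)
    (h : 0 < leftLim u x ∨ leftLim u x = 0 ∧ leftLim w x < 0) :
    ∀ᶠ y in 𝓝[<] x, 0 < leftLim u y ∧ 0 < rightLim u y := by
  have h1 := H.neg.eventually_neg_left hα hx (by
    rw [H.leftLim_neg_fst hx, H.leftLim_neg_snd hx]
    simpa using h)
  filter_upwards [h1, Ioo_mem_nhdsLT hx.1] with y hy hyd
  have hyc : y ∈ Ioo c d := ⟨hyd.1, hyd.2.trans hx.2⟩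
  simpa [H.leftLim_neg_fst hyc, H.rightLim_neg_fst hyc] using hy

/-- If `u` does not change sign at `x`, then it has a strict sign on both sides of `x`. -/
lemma eventually_sign_of_not_changesSignAt [IsFiniteMeasure M] {I : Set ℝ}
    (H : LocalSolution M c d α β u w) (hα : IncreasingLims c d α) (hI : Ioo c d ⊆ I) {x : ℝ}
    (hx : x ∈ Ioo c d) (hl : ¬ (leftLim u x = 0 ∧ leftLim w x = 0))
    (hr : ¬ (rightLim u x = 0 ∧ rightLim w x = 0)) (hn : ¬ ChangesSignAt I u x) :
    (∀ᶠ y in 𝓝[≠] x, 0 < leftLim u y ∧ 0 < rightLim u y) ∨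
      ∀ᶠ y in 𝓝[≠] x, leftLim u y < 0 ∧ rightLim u y < 0 := by
  have hR : (∀ᶠ y in 𝓝[>] x, 0 < leftLim u y ∧ 0 < rightLim u y) ∨
      ∀ᶠ y in 𝓝[>] x, leftLim u y < 0 ∧ rightLim u y < 0 := by
    by_cases h : 0 < rightLim u x ∨ rightLim u x = 0 ∧ 0 < rightLim w x
    · exact .inl (H.eventually_pos_right hα hx h)
    · exact .inr (H.eventually_neg_right hα hx (by grind))
  have hL : (∀ᶠ y in 𝓝[<] x, 0 < leftLim u y ∧ 0 < rightLim u y) ∨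
      ∀ᶠ y in 𝓝[<] x, leftLim u y < 0 ∧ rightLim u y < 0 := by
    by_cases h : leftLim u x < 0 ∨ leftLim u x = 0 ∧ 0 < leftLim w x
    · exact .inr (H.eventually_neg_left hα hx h)
    · exact .inl (H.eventually_pos_left hα hx (by grind))
  have hδ : ∀ {p q : ℝ → Prop}, (∀ᶠ y in 𝓝[<] x, p y) → (∀ᶠ y in 𝓝[>] x, q y) →
      ∃ δ > 0, Ioo (x - δ) (x + δ) ⊆ I ∧ (∀ y ∈ Ioo (x - δ) x, p y) ∧
        ∀ y ∈ Ioo x (x + δ), q y := by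
    intro p q hp hq
    obtain ⟨l, hl, hl'⟩ := mem_nhdsLT_iff_exists_Ioo_subset.1 (hp.and (Ioo_mem_nhdsLT hx.1))
    obtain ⟨r, hr, hr'⟩ := mem_nhdsGT_iff_exists_Ioo_subset.1 (hq.and (Ioo_mem_nhdsGT hx.2))
    have hlx : l < x := hl
    have hxr : x < r := hr
    have h1 : min (x - l) (r - x) ≤ x - l := min_le_left _ _
    have h2 : min (x - l) (r - x) ≤ r - x := min_le_right _ _
    refine ⟨min (x - l) (r - x), lt_min (sub_pos.2 hl) (sub_pos.2 hr), fun y hy => hI ?_,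
      fun y hy => (hl' ⟨by linarith [hy.1], hy.2⟩).1, fun y hy => (hr' ⟨hy.1, by linarith [hy.2]⟩).1⟩
    rcases lt_trichotomy y x with h | h | h
    · exact ⟨(hl' ⟨by linarith [hy.1], h⟩).2.1, h.trans hx.2⟩
    · exact h ▸ hx
    · exact ⟨hx.1.trans h, (hr' ⟨h, by linarith [hy.2]⟩).2.2⟩
  rcases hL with hL | hL <;> rcases hR with hR | hR
  · left
    rw [← nhdsLT_sup_nhdsGT]
    exact eventually_sup.2 ⟨hL, hR⟩
  · obtain ⟨δ, h0, h1, h2, h3⟩ := hδ hL hR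
    exact absurd ⟨δ, h0, h1, .inr ⟨fun y hy => (h2 y hy).1, fun y hy => (h3 y hy).2⟩⟩ hn
  · obtain ⟨δ, h0, h1, h2, h3⟩ := hδ hL hR
    exact absurd ⟨δ, h0, h1, .inl ⟨fun y hy => (h2 y hy).1, fun y hy => (h3 y hy).2⟩⟩ hn
  · right
    rw [← nhdsLT_sup_nhdsGT]
    exact eventually_sup.2 ⟨hL, hR⟩

/-- A solution without sign changes in an interval `J` has a constant weak sign on `J`. -/
lemma nonneg_or_nonpos_of_not_changesSignIn [IsFiniteMeasure M] {I J : Set ℝ}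
    (H : LocalSolution M c d α β u w) (hα : IncreasingLims c d α) (hI : Ioo c d ⊆ I)
    (hJ : J.OrdConnected) (hJc : J ⊆ Ioo c d)
    (hl : ∀ x ∈ Ioo c d, ¬ (leftLim u x = 0 ∧ leftLim w x = 0))
    (hr : ∀ x ∈ Ioo c d, ¬ (rightLim u x = 0 ∧ rightLim w x = 0)) (hn : ¬ ChangesSignIn I u J) :
    (∀ x ∈ J, 0 ≤ leftLim u x ∧ 0 ≤ rightLim u x) ∨
      ∀ x ∈ J, leftLim u x ≤ 0 ∧ rightLim u x ≤ 0 := by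
  rcases J.eq_empty_or_nonempty with rfl | ⟨x₀, hx₀⟩
  · simp
  set P : ℝ → Prop := fun x => ∀ᶠ y in 𝓝[≠] x, 0 < leftLim u y ∧ 0 < rightLim u y
  set N : ℝ → Prop := fun x => ∀ᶠ y in 𝓝[≠] x, leftLim u y < 0 ∧ rightLim u y < 0
  have hPN : ∀ x ∈ J, P x ∨ N x := fun x hx =>
    H.eventually_sign_of_not_changesSignAt hα hI (hJc hx) (hl x (hJc hx)) (hr x (hJc hx))
      fun h => hn ⟨x, hx, h⟩
  have hdisj : ∀ x, P x → N x → False := fun x hp hq => by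
    obtain ⟨y, h1, h2⟩ := (hp.and hq).exists
    exact lt_asymm h1.1 h2.1
  have hpropagate : ∀ {p : ℝ → Prop} {x : ℝ}, (∀ᶠ y in 𝓝[≠] x, p y) →
      ∀ᶠ z in 𝓝 x, ∀ᶠ y in 𝓝[≠] z, p y := by
    intro p x hp
    have h1 := eventually_nhdsWithin_iff.1 (eventually_eventually_nhdsWithin.2 hp)
    filter_upwards [h1] with z hz
    by_cases h : z = x
    · exact h ▸ hp
    · have h2 := hz h
      rw [(isOpen_compl_singleton).nhdsWithin_eq h] at h2
      exact nhdsWithin_le_nhds h2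
  have hconst : ∀ x ∈ J, P x₀ ↔ P x := fun x hx =>
    hJ.isPreconnected.induction₂ (fun y z => P y ↔ P z) (fun y hy => by
      refine nhdsWithin_le_nhds ?_
      rcases hPN y hy with h | h
      · filter_upwards [hpropagate h] with z hz using iff_of_true h hz
      · filter_upwards [hpropagate h] with z hz
        using iff_of_false (fun h' => hdisj y h' h) (fun h' => hdisj z h' hz))
      (fun _ _ _ _ _ _ h1 h2 => h1.trans h2) (fun _ _ _ _ h => h.symm) hx₀ hx
  rcases hPN x₀ hx₀ with h | h
  · left
    intro x hx
    have hP : P x := (hconst x hx).1 h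
    have hlim := H.lims_fst x (hJc hx)
    exact ⟨ge_of_tendsto (tendsto_leftLim_nhdsLT hlim.1)
      ((Filter.Eventually.filter_mono (nhdsLT_le_nhdsNE x) hP).mono fun y hy => hy.1.le),
      ge_of_tendsto (tendsto_leftLim_nhdsGT hlim.2)
      ((Filter.Eventually.filter_mono (nhdsGT_le_nhdsNE x) hP).mono fun y hy => hy.1.le)⟩
  · right
    intro x hx
    have hN : N x := (hPN x hx).resolve_left fun h' => hdisj x₀ ((hconst x hx).2 h') h
    have hlim := H.lims_fst x (hJc hx)
    exact ⟨le_of_tendsto (tendsto_leftLim_nhdsLT hlim.1)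
      ((Filter.Eventually.filter_mono (nhdsLT_le_nhdsNE x) hN).mono fun y hy => hy.1.le),
      le_of_tendsto (tendsto_leftLim_nhdsGT hlim.2)
      ((Filter.Eventually.filter_mono (nhdsGT_le_nhdsNE x) hN).mono fun y hy => hy.1.le)⟩

end LocalSolution

lemma mul_add_mul_sub_lower_bound {U V X Y A d₁ d₂ du dv dx dy p q m : ℝ}
    (hd : 0 ≤ U * V * (d₁ - d₂)) (hu : |du - X * A| ≤ m) (hv : |dv - Y * A| ≤ m)
    (hx : |dx - U * d₁| ≤ m) (hy : |dy - V * d₂| ≤ m) (hp : |p| ≤ m) (hq : |q| ≤ m) :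
    -((|X| + |V| + |Y| + |U| + 2) * m) ≤ X * dv + V * dx - Y * du - U * dy + p - q := by
  have key : ∀ {k e : ℝ}, |e| ≤ m → |k * e| ≤ |k| * m := fun {k e} he => by
    rw [abs_mul]
    gcongr
  have h1 := neg_abs_le (X * (dv - Y * A))
  have h2 := neg_abs_le (V * (dx - U * d₁))
  have h3 := le_abs_self (Y * (du - X * A))
  have h4 := le_abs_self (U * (dy - V * d₂))
  have h5 := (abs_le.1 hp).1
  have h6 := (abs_le.1 hq).2
  have h7 := key (k := X) hv
  have h8 := key (k := V) hx
  have h9 := key (k := Y) hu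
  have h10 := key (k := U) hy
  linarith

namespace LocalSolution

variable {M : Measure ℝ} {c d : ℝ} {α β₁ β₂ u w v z : ℝ → ℝ}

/-- The Wronskian `v w - u z` of a pair of nonnegative solutions is nondecreasing. -/
lemma wronskian_le [IsFiniteMeasure M] (Hu : LocalSolution M c d α β₁ u w)
    (Hv : LocalSolution M c d α β₂ v z) {s t : ℝ} (hcs : c < s) (hst : s < t) (htd : t < d)
    (hu : ∀ x ∈ Ioo s t, 0 ≤ leftLim u x ∧ 0 ≤ rightLim u x)
    (hv : ∀ x ∈ Ioo s t, 0 ≤ leftLim v x ∧ 0 ≤ rightLim v x)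
    (hj : ∀ x ∈ Ioo s t, 0 ≤ rightLim β₁ x - leftLim β₁ x - (rightLim β₂ x - leftLim β₂ x))
    (hi : ∀ x ∈ Icc s t, ∀ y ∈ Icc s t, x < y →
      0 ≤ leftLim β₁ y - rightLim β₁ x - (leftLim β₂ y - rightLim β₂ x)) :
    rightLim v s * rightLim w s - rightLim u s * rightLim z s ≤
      leftLim v t * leftLim w t - leftLim u t * leftLim z t := by
  have hsub : ∀ x ∈ Icc s t, x ∈ Ioo c d := fun x hx =>
    ⟨hcs.trans_le hx.1, hx.2.trans_lt htd⟩
  refine le_of_local_increments (M := M)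
    (Fl := fun x => leftLim v x * leftLim w x - leftLim u x * leftLim z x)
    (Fr := fun x => rightLim v x * rightLim w x - rightLim u x * rightLim z x) hst ?_ ?_ ?_
  · intro x hx
    have hx' := hsub x (Ioo_subset_Icc_self hx)
    have h1 := Hu.eq_fst.jump_eq x hx'
    have h2 := Hu.eq_snd.jump_eq x hx'
    have h3 := Hv.eq_fst.jump_eq x hx'
    have h4 := Hv.eq_snd.jump_eq x hx'
    have h5 : 0 ≤ u x := by
      rw [Hu.bal_fst x hx']
      linarith [(hu x hx).1, (hu x hx).2]
    have h6 : 0 ≤ v x := by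
      rw [Hv.bal_fst x hx']
      linarith [(hv x hx).1, (hv x hx).2]
    have h7 := mul_nonneg (mul_nonneg h5 h6) (hj x hx)
    have h8 : rightLim v x * rightLim w x - rightLim u x * rightLim z x -
        (leftLim v x * leftLim w x - leftLim u x * leftLim z x) =
        v x * (rightLim w x - leftLim w x) + w x * (rightLim v x - leftLim v x) -
        u x * (rightLim z x - leftLim z x) - z x * (rightLim u x - leftLim u x) := by
      rw [Hu.bal_fst x hx', Hv.bal_fst x hx', Hu.bal_snd x hx', Hv.bal_snd x hx']
      ring
    rw [h1, h2, h3, h4] at h8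
    rw [← sub_nonneg, h8]
    linarith
  · intro x hx ε hε
    have hx' := hsub x (Ico_subset_Icc_self hx)
    have hu0 : 0 ≤ rightLim u x := ge_of_tendsto (tendsto_rightLim_nhdsGT (Hu.lims_fst x hx').2) <| by
      filter_upwards [Ioo_mem_nhdsGT hx.2] with y hy using (hu y ⟨hx.1.trans_lt hy.1, hy.2⟩).2
    have hv0 : 0 ≤ rightLim v x := ge_of_tendsto (tendsto_rightLim_nhdsGT (Hv.lims_fst x hx').2) <| by
      filter_upwards [Ioo_mem_nhdsGT hx.2] with y hy using (hv y ⟨hx.1.trans_lt hy.1, hy.2⟩).2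
    have hC : 0 < |rightLim w x| + |rightLim v x| + |rightLim z x| + |rightLim u x| + 2 := by
      positivity
    have hη := div_pos hε hC
    have hw1 : Tendsto (fun y => leftLim w y - rightLim w x) (𝓝[>] x) (𝓝 0) := by
      simpa using (tendsto_leftLim_nhdsGT (Hu.lims_snd x hx').2).sub_const (rightLim w x)
    have hz1 : Tendsto (fun y => leftLim z y - rightLim z x) (𝓝[>] x) (𝓝 0) := by
      simpa using (tendsto_leftLim_nhdsGT (Hv.lims_snd x hx').2).sub_const (rightLim z x)
    filter_upwards [Hu.eq_fst.eventually_right hx' (Hu.lims_snd x hx').2 hη,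
      Hv.eq_fst.eventually_right hx' (Hv.lims_snd x hx').2 hη,
      Hu.eq_snd.eventually_right hx' (Hu.lims_fst x hx').2 hη,
      Hv.eq_snd.eventually_right hx' (Hv.lims_fst x hx').2 hη,
      Hv.eq_fst.eventually_right_mul hx' (Hv.lims_snd x hx').2 hw1 hη,
      Hu.eq_fst.eventually_right_mul hx' (Hu.lims_snd x hx').2 hz1 hη,
      Ioo_mem_nhdsGT hx.2] with y h1 h2 h3 h4 h5 h6 hy
    have h7 := mul_add_mul_sub_lower_bound (mul_nonneg (mul_nonneg hu0 hv0)
      (hi x (Ico_subset_Icc_self hx) y ⟨hx.1.trans hy.1.le, hy.2.le⟩ hy.1)) h1 h2 h3 h4 h5 h6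
    rw [← mul_assoc, mul_div_cancel₀ _ hC.ne'] at h7
    linarith
  · intro x hx ε hε
    have hx' := hsub x (Ioc_subset_Icc_self hx)
    have hu0 : 0 ≤ leftLim u x := ge_of_tendsto (tendsto_leftLim_nhdsLT (Hu.lims_fst x hx').1) <| by
      filter_upwards [Ioo_mem_nhdsLT hx.1] with y hy using (hu y ⟨hy.1, hy.2.trans_le hx.2⟩).1
    have hv0 : 0 ≤ leftLim v x := ge_of_tendsto (tendsto_leftLim_nhdsLT (Hv.lims_fst x hx').1) <| by
      filter_upwards [Ioo_mem_nhdsLT hx.1] with y hy using (hv y ⟨hy.1, hy.2.trans_le hx.2⟩).1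
    have hC : 0 < |leftLim w x| + |leftLim v x| + |leftLim z x| + |leftLim u x| + 2 := by
      positivity
    have hη := div_pos hε hC
    have hw1 : Tendsto (fun y => leftLim w x - rightLim w y) (𝓝[<] x) (𝓝 0) := by
      simpa using (tendsto_rightLim_nhdsLT (Hu.lims_snd x hx').1).const_sub (leftLim w x)
    have hz1 : Tendsto (fun y => leftLim z x - rightLim z y) (𝓝[<] x) (𝓝 0) := by
      simpa using (tendsto_rightLim_nhdsLT (Hv.lims_snd x hx').1).const_sub (leftLim z x)
    filter_upwards [Hu.eq_fst.eventually_left hx' (Hu.lims_snd x hx').1 hη,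
      Hv.eq_fst.eventually_left hx' (Hv.lims_snd x hx').1 hη,
      Hu.eq_snd.eventually_left hx' (Hu.lims_fst x hx').1 hη,
      Hv.eq_snd.eventually_left hx' (Hv.lims_fst x hx').1 hη,
      Hv.eq_fst.eventually_left_mul hx' (Hv.lims_snd x hx').1 hw1 hη,
      Hu.eq_fst.eventually_left_mul hx' (Hu.lims_snd x hx').1 hz1 hη,
      Ioo_mem_nhdsLT hx.1] with y h1 h2 h3 h4 h5 h6 hy
    have h7 := mul_add_mul_sub_lower_bound (mul_nonneg (mul_nonneg hu0 hv0)
      (hi y ⟨hy.1.le, hy.2.le.trans hx.2⟩ x (Ioc_subset_Icc_self hx) hy.2)) h1 h2 h3 h4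
      ((abs_neg _).trans_le h5) ((abs_neg _).trans_le h6)
    rw [← mul_assoc, mul_div_cancel₀ _ hC.ne'] at h7
    linarith

end LocalSolution

namespace LocalSolution

variable {M : Measure ℝ} {c d : ℝ} {α β β₁ β₂ u w v z : ℝ → ℝ}

lemma jump_mul_wronskian (Hu : LocalSolution M c d α β₁ u w) (Hv : LocalSolution M c d α β₂ v z)
    {x : ℝ} (hx : x ∈ Ioo c d) : jump α x * (v x * w x - u x * z x) =
      rightLim u x * leftLim v x - leftLim u x * rightLim v x := by
  have h1 := Hu.eq_fst.jump_eq x hx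
  have h2 := Hv.eq_fst.jump_eq x hx
  have h3 := Hu.bal_fst x hx
  have h4 := Hv.bal_fst x hx
  rw [jump]
  linear_combination -v x * h1 + u x * h2 +
    (rightLim u x - leftLim u x) * h4 - (rightLim v x - leftLim v x) * h3

lemma wronskian_right_eq (Hu : LocalSolution M c d α β₁ u w) (Hv : LocalSolution M c d α β₂ v z)
    {x : ℝ} (hx : x ∈ Ioo c d) :
    rightLim v x * rightLim w x - rightLim u x * rightLim z x =
      omegaFn α β₁ x * (v x * w x - u x * z x) +
        v x * rightLim u x * (jump β₁ x - jump β₂ x) / 2 := by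
  have h1 : rightLim u x = u x + w x * jump α x / 2 := by
    rw [jump]; linarith [Hu.bal_fst x hx, Hu.eq_fst.jump_eq x hx]
  have h2 : rightLim w x = w x + u x * jump β₁ x / 2 := by
    rw [jump]; linarith [Hu.bal_snd x hx, Hu.eq_snd.jump_eq x hx]
  have h3 : rightLim v x = v x + z x * jump α x / 2 := by
    rw [jump]; linarith [Hv.bal_fst x hx, Hv.eq_fst.jump_eq x hx]
  have h4 : rightLim z x = z x + v x * jump β₂ x / 2 := by
    rw [jump]; linarith [Hv.bal_snd x hx, Hv.eq_snd.jump_eq x hx]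
  rw [h1, h2, h3, h4, omegaFn]
  ring

lemma wronskian_left_eq (Hu : LocalSolution M c d α β₁ u w) (Hv : LocalSolution M c d α β₂ v z)
    {x : ℝ} (hx : x ∈ Ioo c d) :
    leftLim v x * leftLim w x - leftLim u x * leftLim z x =
      omegaFn α β₁ x * (v x * w x - u x * z x) -
        v x * leftLim u x * (jump β₁ x - jump β₂ x) / 2 := by
  have h1 : leftLim u x = u x - w x * jump α x / 2 := by
    rw [jump]; linarith [Hu.bal_fst x hx, Hu.eq_fst.jump_eq x hx]
  have h2 : leftLim w x = w x - u x * jump β₁ x / 2 := by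
    rw [jump]; linarith [Hu.bal_snd x hx, Hu.eq_snd.jump_eq x hx]
  have h3 : leftLim v x = v x - z x * jump α x / 2 := by
    rw [jump]; linarith [Hv.bal_fst x hx, Hv.eq_fst.jump_eq x hx]
  have h4 : leftLim z x = z x - v x * jump β₂ x / 2 := by
    rw [jump]; linarith [Hv.bal_snd x hx, Hv.eq_snd.jump_eq x hx]
  rw [h1, h2, h3, h4, omegaFn]
  ring

lemma jump_pos (H : LocalSolution M c d α β u w) (hα : IncreasingLims c d α) {x : ℝ}
    (hx : x ∈ Ioo c d) (h : leftLim u x ≠ rightLim u x) : 0 < jump α x := by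
  refine (sub_nonneg.2 (hα.left_le_right x hx)).lt_of_ne fun h0 => h ?_
  have h1 := H.eq_fst.jump_eq x hx
  rw [← h0, mul_zero] at h1
  linarith

lemma left_or_right_ne_zero (H : LocalSolution M c d α β u w) {x : ℝ} (hx : x ∈ Ioo c d)
    (hα : 0 < jump α x) (hl : ¬ (leftLim u x = 0 ∧ leftLim w x = 0)) :
    leftLim u x ≠ 0 ∨ rightLim u x ≠ 0 := by
  by_contra! h
  have h1 := H.eq_fst.jump_eq x hx
  have h2 := H.eq_snd.jump_eq x hx
  have h3 := H.bal_fst x hx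
  have h4 := H.bal_snd x hx
  rw [h.1, h.2] at h1 h3
  rw [sub_zero, eq_comm] at h1
  have h5 := (mul_eq_zero.1 h1).resolve_right hα.ne'
  rw [h3] at h2
  exact hl ⟨h.1, by linarith⟩

lemma wronskian_right_nonneg (Hu : LocalSolution M c d α β₁ u w)
    (Hv : LocalSolution M c d α β₂ v z) (hα : IncreasingLims c d α) {x : ℝ} (hx : x ∈ Ioo c d)
    (hω : 0 < omegaFn α β₁ x) (hβ : 0 ≤ jump β₁ x - jump β₂ x) (hv₁ : 0 ≤ leftLim v x)
    (hv₂ : 0 ≤ rightLim v x) (hl : ¬ (leftLim v x = 0 ∧ leftLim z x = 0))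
    (hu₁ : leftLim u x ≤ 0) (hu₂ : 0 < rightLim u x) :
    0 ≤ rightLim v x * rightLim w x - rightLim u x * rightLim z x ∧ (leftLim u x < 0 →
      0 < rightLim v x * rightLim w x - rightLim u x * rightLim z x) := by
  have hA := Hu.jump_pos hα hx (hu₁.trans_lt hu₂).ne
  have hvx : 0 ≤ v x := by rw [Hv.bal_fst x hx]; linarith
  have h1 := Hu.jump_mul_wronskian Hv hx
  rw [Hu.wronskian_right_eq Hv hx]
  have h2 := mul_nonneg (mul_nonneg hvx hu₂.le) hβ
  have h3 := mul_nonneg hu₂.le hv₁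
  have h4 := mul_nonneg (neg_nonneg.2 hu₁) hv₂
  constructor
  · have h5 : 0 ≤ v x * w x - u x * z x := nonneg_of_mul_nonneg_right (by linarith) hA
    have := mul_nonneg hω.le h5
    linarith
  · intro hu₁'
    have h5 : 0 < v x * w x - u x * z x := by
      refine pos_of_mul_pos_right (a := jump α x) ?_ hA.le
      rcases Hv.left_or_right_ne_zero hx hA hl with h | h
      · linarith [mul_pos hu₂ (hv₁.lt_of_ne' h)]
      · linarith [mul_pos (neg_pos.2 hu₁') (hv₂.lt_of_ne' h)]
    have := mul_pos hω h5
    linarith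

lemma wronskian_left_nonpos (Hu : LocalSolution M c d α β₁ u w)
    (Hv : LocalSolution M c d α β₂ v z) (hα : IncreasingLims c d α) {x : ℝ} (hx : x ∈ Ioo c d)
    (hω : 0 < omegaFn α β₁ x) (hβ : 0 ≤ jump β₁ x - jump β₂ x) (hv₁ : 0 ≤ leftLim v x)
    (hv₂ : 0 ≤ rightLim v x) (hl : ¬ (leftLim v x = 0 ∧ leftLim z x = 0))
    (hu₁ : 0 < leftLim u x) (hu₂ : rightLim u x ≤ 0) :
    leftLim v x * leftLim w x - leftLim u x * leftLim z x ≤ 0 ∧ (rightLim u x < 0 →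
      leftLim v x * leftLim w x - leftLim u x * leftLim z x < 0) := by
  have hA := Hu.jump_pos hα hx (hu₂.trans_lt hu₁).ne'
  have hvx : 0 ≤ v x := by rw [Hv.bal_fst x hx]; linarith
  have h1 := Hu.jump_mul_wronskian Hv hx
  rw [Hu.wronskian_left_eq Hv hx]
  have h2 := mul_nonneg (mul_nonneg hvx hu₁.le) hβ
  have h3 := mul_nonneg hu₁.le hv₂
  have h4 := mul_nonneg (neg_nonneg.2 hu₂) hv₁
  constructor
  · have h5 : 0 ≤ u x * z x - v x * w x := nonneg_of_mul_nonneg_right (by linarith) hA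
    have := mul_nonneg hω.le h5
    linarith
  · intro hu₂'
    have h5 : 0 < u x * z x - v x * w x := by
      refine pos_of_mul_pos_right (a := jump α x) ?_ hA.le
      rcases Hv.left_or_right_ne_zero hx hA hl with h | h
      · linarith [mul_pos (neg_pos.2 hu₂') (hv₁.lt_of_ne' h)]
      · linarith [mul_pos hu₁ (hv₂.lt_of_ne' h)]
    have := mul_pos hω h5
    linarith

/-- Nonnegativity of the measure `d(β₁ - β₂)` and the boundary conditions at `s` and `t` are
incompatible with a solution `u` positive on `(s,t)` and a nonnegative solution `v`. -/
lemma false_of_pos_of_nonneg [IsFiniteMeasure M] (Hu : LocalSolution M c d α β₁ u w)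
    (Hv : LocalSolution M c d α β₂ v z) (hα : IncreasingLims c d α)
    (hβ₁ : HasOneSidedLims β₁ (Ioo c d)) (hβ₂ : HasOneSidedLims β₂ (Ioo c d)) {s t : ℝ} {J : Set ℝ}
    (hs : s ∈ Ioo c d) (ht : t ∈ Ioo c d) (hst : s < t) (hJ : Ioo s t ⊆ J)
    (hl : ∀ x ∈ Ioo c d, ¬ (leftLim v x = 0 ∧ leftLim z x = 0))
    (hpos : PosMeasureOn (fun x => β₁ x - β₂ x) J)
    (hu : ∀ x ∈ Ioo s t, 0 < leftLim u x ∧ 0 < rightLim u x)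
    (hv : ∀ x ∈ J, 0 ≤ leftLim v x ∧ 0 ≤ rightLim v x)
    (hL : rightLim u s = 0 ∨ s ∈ J ∧ leftLim u s * rightLim u s ≤ 0 ∧ 0 < omegaFn α β₁ s)
    (hR : leftLim u t = 0 ∨ t ∈ J ∧ leftLim u t * rightLim u t ≤ 0 ∧ 0 < omegaFn α β₁ t)
    (hLR : leftLim u s * rightLim u s < 0 ∨ leftLim u t * rightLim u t < 0) : False := by
  have hleft : ∀ x ∈ Ioo c d, leftLim (fun x => β₁ x - β₂ x) x = leftLim β₁ x - leftLim β₂ x :=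
    fun x hx => leftLim_eq_of_tendsto ((hβ₁ x hx).1.sub (hβ₂ x hx).1)
  have hright : ∀ x ∈ Ioo c d,
      rightLim (fun x => β₁ x - β₂ x) x = rightLim β₁ x - rightLim β₂ x :=
    fun x hx => rightLim_eq_of_tendsto ((hβ₁ x hx).2.sub (hβ₂ x hx).2)
  have hsub : ∀ x ∈ Icc s t, x ∈ Ioo c d := fun x hx =>
    ⟨hs.1.trans_le hx.1, hx.2.trans_lt ht.2⟩
  have hj : ∀ x ∈ J, x ∈ Icc s t → 0 ≤ jump β₁ x - jump β₂ x := by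
    intro x hx hxst
    have := hpos.1 x x le_rfl (by simpa using hx)
    rw [hleft x (hsub x hxst), hright x (hsub x hxst)] at this
    rw [jump, jump]
    linarith
  have hmono := Hu.wronskian_le Hv hs.1 hst ht.2 (fun x hx => ⟨(hu x hx).1.le, (hu x hx).2.le⟩)
    (fun x hx => hv x (hJ hx)) (fun x hx => hj x (hJ hx) (Ioo_subset_Icc_self hx))
    (fun x hx y hy hxy => by
      have := hpos.2.2.2 x y hxy ((Ioo_subset_Ioo hx.1 hy.2).trans hJ)
      rw [hleft y (hsub y hy), hright x (hsub x hx)] at this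
      linarith)
  have hus : 0 ≤ rightLim u s := ge_of_tendsto (tendsto_rightLim_nhdsGT (Hu.lims_fst s hs).2) <| by
    filter_upwards [Ioo_mem_nhdsGT hst] with y hy using (hu y hy).2.le
  have hvs : 0 ≤ rightLim v s := ge_of_tendsto (tendsto_rightLim_nhdsGT (Hv.lims_fst s hs).2) <| by
    filter_upwards [Ioo_mem_nhdsGT hst] with y hy using (hv y (hJ hy)).2
  have hut : 0 ≤ leftLim u t := ge_of_tendsto (tendsto_leftLim_nhdsLT (Hu.lims_fst t ht).1) <| by
    filter_upwards [Ioo_mem_nhdsLT hst] with y hy using (hu y hy).1.le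
  have hvt : 0 ≤ leftLim v t := ge_of_tendsto (tendsto_leftLim_nhdsLT (Hv.lims_fst t ht).1) <| by
    filter_upwards [Ioo_mem_nhdsLT hst] with y hy using (hv y (hJ hy)).1
  have hS : 0 ≤ rightLim v s * rightLim w s - rightLim u s * rightLim z s ∧
      (leftLim u s * rightLim u s < 0 →
        0 < rightLim v s * rightLim w s - rightLim u s * rightLim z s) := by
    rcases hus.eq_or_lt' with h0 | h0
    · have hw : 0 ≤ rightLim w s := by
        by_contra! hw
        obtain ⟨y, h1, h2⟩ := ((Hu.eventually_neg_right hα hs (.inr ⟨h0, hw⟩)).and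
          (Ioo_mem_nhdsGT hst)).exists
        exact lt_asymm h1.1 (hu y h2).1
      rw [h0]
      simpa using mul_nonneg hvs hw
    · obtain ⟨hsJ, hprod, hω⟩ := hL.resolve_left h0.ne'
      obtain ⟨h1, h2⟩ := Hu.wronskian_right_nonneg Hv hα hs hω (hj s hsJ (left_mem_Icc.2 hst.le))
        (hv s hsJ).1 hvs (hl s hs) (nonpos_of_mul_nonpos_left hprod h0) h0
      exact ⟨h1, fun h => h2 (neg_of_mul_neg_left h h0.le)⟩
  have hT : leftLim v t * leftLim w t - leftLim u t * leftLim z t ≤ 0 ∧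
      (leftLim u t * rightLim u t < 0 →
        leftLim v t * leftLim w t - leftLim u t * leftLim z t < 0) := by
    rcases hut.eq_or_lt' with h0 | h0
    · have hw : leftLim w t ≤ 0 := by
        by_contra! hw
        obtain ⟨y, h1, h2⟩ := ((Hu.eventually_neg_left hα ht (.inr ⟨h0, hw⟩)).and
          (Ioo_mem_nhdsLT hst)).exists
        exact lt_asymm h1.1 (hu y h2).1
      rw [h0]
      simpa using mul_nonpos_of_nonneg_of_nonpos hvt hw
    · obtain ⟨htJ, hprod, hω⟩ := hR.resolve_left h0.ne'
      obtain ⟨h1, h2⟩ := Hu.wronskian_left_nonpos Hv hα ht hω (hj t htJ (right_mem_Icc.2 hst.le))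
        hvt (hv t htJ).2 (hl t ht) h0 (nonpos_of_mul_nonpos_right hprod h0)
      exact ⟨h1, fun h => h2 (neg_of_mul_neg_right h h0.le)⟩
  rcases hLR with h | h
  · linarith [hS.2 h, hT.1]
  · linarith [hS.1, hT.2 h]

/-- A solution without sign-changing points in an open interval has a constant strict sign there. -/
lemma pos_or_neg_of_zSet_eq_empty (H : LocalSolution M c d α β u w) {s t : ℝ}
    (hst : Ioo s t ⊆ Ioo c d) (hZ : ZSet u (Ioo s t) = ∅) :
    (∀ x ∈ Ioo s t, 0 < leftLim u x ∧ 0 < rightLim u x) ∨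
      ∀ x ∈ Ioo s t, leftLim u x < 0 ∧ rightLim u x < 0 := by
  have hprod : ∀ x ∈ Ioo s t, 0 < leftLim u x * rightLim u x := fun x hx => by
    by_contra! h
    exact eq_empty_iff_forall_notMem.1 hZ x ⟨hx, h⟩
  have hconst : ∀ x ∈ Ioo s t, ∀ y ∈ Ioo s t, 0 < leftLim u x ↔ 0 < leftLim u y := fun x hx y hy => by
    refine isPreconnected_Ioo.induction₂ (fun x y => 0 < leftLim u x ↔ 0 < leftLim u y)
      (fun p hp => nhdsWithin_le_nhds ?_) (fun _ _ _ _ _ _ h1 h2 => h1.trans h2)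
      (fun _ _ _ _ h => h.symm) hx hy
    suffices h : (∀ᶠ q in 𝓝[<] p, 0 < leftLim u p ↔ 0 < leftLim u q) ∧
        ∀ᶠ q in 𝓝[>] p, 0 < leftLim u p ↔ 0 < leftLim u q by
      have := eventually_sup.2 h
      rw [nhdsLT_sup_nhdsGT, eventually_nhdsWithin_iff] at this
      filter_upwards [this] with q hq
      by_cases h : q = p
      · rw [h]
      · exact hq h
    have hp' := H.lims_fst p (hst hp)
    rcases pos_and_pos_or_neg_and_neg_of_mul_pos (hprod p hp) with ⟨h1, h2⟩ | ⟨h1, h2⟩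
    · constructor
      · filter_upwards [(tendsto_leftLim_nhdsLT hp'.1).eventually_const_lt h1] with q hq
          using iff_of_true h1 hq
      · filter_upwards [(tendsto_leftLim_nhdsGT hp'.2).eventually_const_lt h2] with q hq
          using iff_of_true h1 hq
    · constructor
      · filter_upwards [(tendsto_leftLim_nhdsLT hp'.1).eventually_lt_const h1] with q hq
          using iff_of_false h1.not_gt hq.not_gt
      · filter_upwards [(tendsto_leftLim_nhdsGT hp'.2).eventually_lt_const h2] with q hq
          using iff_of_false h1.not_gt hq.not_gt
  by_cases hex : ∃ x ∈ Ioo s t, 0 < leftLim u x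
  · obtain ⟨x, hx, h⟩ := hex
    exact .inl fun y hy =>
      have h1 := (hconst x hx y hy).1 h
      ⟨h1, pos_of_mul_pos_right (hprod y hy) h1.le⟩
  · push Not at hex
    exact .inr fun y hy => by
      rcases pos_and_pos_or_neg_and_neg_of_mul_pos (hprod y hy) with h | h
      · exact absurd (hex y hy) h.1.not_ge
      · exact h

lemma changesSignIn_of_zSet_eq_empty [IsFiniteMeasure M] (Hu : LocalSolution M c d α β₁ u w)
    (Hv : LocalSolution M c d α β₂ v z) (hα : IncreasingLims c d α)
    (hβ₁ : HasOneSidedLims β₁ (Ioo c d)) (hβ₂ : HasOneSidedLims β₂ (Ioo c d)) {s t : ℝ}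
    {I J : Set ℝ} (hI : Ioo c d ⊆ I) (hs : s ∈ Ioo c d) (ht : t ∈ Ioo c d) (hst : s < t)
    (hJ : Ioo s t ⊆ J) (hJ' : J ⊆ Icc s t) (hJo : J.OrdConnected)
    (hω : ∀ x ∈ Ioo c d, omegaFn α β₂ x ≠ 0) (hv : ∃ x ∈ Ioo c d, v x ≠ 0)
    (hpos : PosMeasureOn (fun x => β₁ x - β₂ x) J) (hZ : ZSet u (Ioo s t) = ∅)
    (hL : rightLim u s = 0 ∨ s ∈ J ∧ leftLim u s * rightLim u s ≤ 0 ∧ 0 < omegaFn α β₁ s)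
    (hR : leftLim u t = 0 ∨ t ∈ J ∧ leftLim u t * rightLim u t ≤ 0 ∧ 0 < omegaFn α β₁ t)
    (hLR : leftLim u s * rightLim u s < 0 ∨ leftLim u t * rightLim u t < 0) :
    ChangesSignIn I v J := by
  obtain ⟨x₀, hx₀, hv₀⟩ := hv
  have hl : ∀ x ∈ Ioo c d, ¬ (leftLim v x = 0 ∧ leftLim z x = 0) := fun x hx =>
    Hv.left_ne_zero hω hx₀ hv₀ hx
  have hr : ∀ x ∈ Ioo c d, ¬ (rightLim v x = 0 ∧ rightLim z x = 0) := fun x hx =>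
    mt (Hv.left_eq_zero_iff_right_eq_zero hx (hω x hx)).2 (hl x hx)
  have hIcc : ∀ x ∈ Icc s t, x ∈ Ioo c d := fun x hx =>
    ⟨hs.1.trans_le hx.1, hx.2.trans_lt ht.2⟩
  have hJc : J ⊆ Ioo c d := fun x hx => hIcc x (hJ' hx)
  have main : ∀ {u w v z : ℝ → ℝ}, LocalSolution M c d α β₁ u w → LocalSolution M c d α β₂ v z →
      (∀ x ∈ Ioo c d, ¬ (leftLim v x = 0 ∧ leftLim z x = 0)) →
      (∀ x ∈ Ioo s t, 0 < leftLim u x ∧ 0 < rightLim u x) →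
      (rightLim u s = 0 ∨ s ∈ J ∧ leftLim u s * rightLim u s ≤ 0 ∧ 0 < omegaFn α β₁ s) →
      (leftLim u t = 0 ∨ t ∈ J ∧ leftLim u t * rightLim u t ≤ 0 ∧ 0 < omegaFn α β₁ t) →
      (leftLim u s * rightLim u s < 0 ∨ leftLim u t * rightLim u t < 0) →
      ¬ ∀ x ∈ J, 0 ≤ leftLim v x ∧ 0 ≤ rightLim v x :=
    fun Hu Hv hl hu hL hR hLR hv =>
      Hu.false_of_pos_of_nonneg Hv hα hβ₁ hβ₂ hs ht hst hJ hl hpos hu hv hL hR hLR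
  have main' : ∀ {u w : ℝ → ℝ}, LocalSolution M c d α β₁ u w →
      (∀ x ∈ Ioo s t, 0 < leftLim u x ∧ 0 < rightLim u x) →
      (rightLim u s = 0 ∨ s ∈ J ∧ leftLim u s * rightLim u s ≤ 0 ∧ 0 < omegaFn α β₁ s) →
      (leftLim u t = 0 ∨ t ∈ J ∧ leftLim u t * rightLim u t ≤ 0 ∧ 0 < omegaFn α β₁ t) →
      (leftLim u s * rightLim u s < 0 ∨ leftLim u t * rightLim u t < 0) → ChangesSignIn I v J := by
    intro u w Hu hu hL hR hLR
    by_contra hn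
    rcases Hv.nonneg_or_nonpos_of_not_changesSignIn hα hI hJo hJc hl hr hn with h | h
    · exact main Hu Hv hl hu hL hR hLR h
    · refine main Hu Hv.neg (fun x hx => ?_) hu hL hR hLR fun x hx => ?_
      · rw [Hv.leftLim_neg_fst hx, Hv.leftLim_neg_snd hx, neg_eq_zero, neg_eq_zero]
        exact hl x hx
      · rw [Hv.leftLim_neg_fst (hJc hx), Hv.rightLim_neg_fst (hJc hx), neg_nonneg, neg_nonneg]
        exact h x hx
  rcases Hu.pos_or_neg_of_zSet_eq_empty (fun x hx => hIcc x (Ioo_subset_Icc_self hx)) hZ with h | h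
  · exact main' Hu h hL hR hLR
  · refine main' Hu.neg (fun x hx => ?_) ?_ ?_ ?_
    · have hx' := hIcc x (Ioo_subset_Icc_self hx)
      rw [Hu.leftLim_neg_fst hx', Hu.rightLim_neg_fst hx', neg_pos, neg_pos]
      exact h x hx
    · rwa [Hu.leftLim_neg_fst hs, Hu.rightLim_neg_fst hs, neg_eq_zero, neg_mul_neg]
    · rwa [Hu.leftLim_neg_fst ht, Hu.rightLim_neg_fst ht, neg_eq_zero, neg_mul_neg]
    · rwa [Hu.leftLim_neg_fst hs, Hu.rightLim_neg_fst hs, Hu.leftLim_neg_fst ht,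
        Hu.rightLim_neg_fst ht, neg_mul_neg, neg_mul_neg]

end LocalSolution

lemma RBalanced.eq_average {I : Set ℝ} {f : ℝ → ℝ} (h : RBalanced (1 / 2) I f) {x : ℝ}
    (hx : x ∈ I) : f x = (leftLim f x + rightLim f x) / 2 := by
  rw [h.2 x hx]
  ring

/-- Two solutions on `(a,b)` restrict to local solutions dominated by a common finite measure. -/
lemma IsHomSol.exists_localSolution {a b : EReal} {α β₁ β₂ u w v z : ℝ → ℝ}
    (hu : IsHomSol (EI a b) (1 / 2) α β₁ u w) (hv : IsHomSol (EI a b) (1 / 2) α β₂ v z)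
    (hα : LocallyBoundedVariationOn α (EI a b)) (hβ₁ : LocallyBoundedVariationOn β₁ (EI a b))
    (hβ₂ : LocallyBoundedVariationOn β₂ (EI a b)) {c d : ℝ} (hc : c ∈ EI a b) (hd : d ∈ EI a b)
    (hcd : c < d) : ∃ M : Measure ℝ, IsFiniteMeasure M ∧ LocalSolution M c d α β₁ u w ∧
      LocalSolution M c d α β₂ v z := by
  have hsub : Ioo c d ⊆ EI a b := Ioo_subset_Icc_self.trans (Icc_subset_EI hc hd)
  obtain ⟨hu1, hu2, hu3, hu4⟩ := hu
  obtain ⟨hv1, hv2, hv3, hv4⟩ := hv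
  obtain ⟨M₁, _, h1⟩ := hu3.exists_stieltjesEq hu1.1 hu2.1 hα hc hd hcd
  obtain ⟨M₂, _, h2⟩ := hu4.exists_stieltjesEq hu2.1 hu1.1 hβ₁ hc hd hcd
  obtain ⟨M₃, _, h3⟩ := hv3.exists_stieltjesEq hv1.1 hv2.1 hα hc hd hcd
  obtain ⟨M₄, _, h4⟩ := hv4.exists_stieltjesEq hv2.1 hv1.1 hβ₂ hc hd hcd
  have hl : ∀ {f : ℝ → ℝ}, RBalanced (1 / 2) (EI a b) f → HasOneSidedLims f (Ioo c d) := fun hf =>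
    (hasOneSidedLims_of_locallyBoundedVariationOn hf.1).mono hsub
  refine ⟨M₁ + M₂ + (M₃ + M₄), inferInstance,
    ⟨hl hu1, hl hu2, fun x hx => hu1.eq_average (hsub hx), fun x hx => hu2.eq_average (hsub hx),
      h1.mono ?_, h2.mono ?_⟩,
    ⟨hl hv1, hl hv2, fun x hx => hv1.eq_average (hsub hx), fun x hx => hv2.eq_average (hsub hx),
      h3.mono ?_, h4.mono ?_⟩⟩
  · exact Measure.le_add_right (Measure.le_add_right le_rfl)
  · exact Measure.le_add_right (Measure.le_add_left le_rfl)
  · exact Measure.le_add_left (Measure.le_add_right le_rfl)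
  · exact Measure.le_add_left (Measure.le_add_left le_rfl)

lemma exists_Ioo_mem_EI {a b : EReal} {x y : ℝ} (hx : x ∈ EI a b) (hy : y ∈ EI a b) :
    ∃ c ∈ EI a b, ∃ d ∈ EI a b, c < x ∧ y < d := by
  obtain ⟨c, hc, hcx⟩ := Filter.nonempty_of_mem (inter_mem (mem_nhdsWithin_of_mem_nhds
    ((isOpen_EI a b).mem_nhds hx)) (self_mem_nhdsWithin : Iio x ∈ 𝓝[<] x))
  obtain ⟨d, hd, hyd⟩ := Filter.nonempty_of_mem (inter_mem (mem_nhdsWithin_of_mem_nhds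
    ((isOpen_EI a b).mem_nhds hy)) (self_mem_nhdsWithin : Ioi y ∈ 𝓝[>] y))
  exact ⟨c, hc, d, hd, hcx, hyd⟩

/-- Sturm Comparison Theorem II, Theorem 6.5. -/
theorem statement19 (a b : EReal) (hab : a < b) (α β₁ β₂ : ℝ → ℝ)
    (hα : StrictMonoOn α (EI a b))
    (hβ₁ : LocallyBoundedVariationOn β₁ (EI a b))
    (hβ₂ : LocallyBoundedVariationOn β₂ (EI a b))
    (hω : ∀ x ∈ EI a b, omegaFn α β₁ x ≠ 0 ∧ omegaFn α β₂ x ≠ 0)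
    (u wu v wv : ℝ → ℝ)
    (hu : IsHomSol (EI a b) (1 / 2) α β₁ u wu)
    (hv : IsHomSol (EI a b) (1 / 2) α β₂ v wv)
    (hnu : ¬ ∀ x ∈ EI a b, u x = 0) (hnv : ¬ ∀ x ∈ EI a b, v x = 0)
    (s t : ℝ) (hst : s < t)
    (hs : s ∈ ZSet u (EI a b)) (ht : t ∈ ZSet u (EI a b))
    (hcons : ZSet u (Ioo s t) = ∅) :
    (leftLim u s * rightLim u s < 0 → leftLim u t = 0 → 0 < omegaFn α β₁ s →
      PosMeasureOn (fun x => β₁ x - β₂ x) (Ico s t) →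
      ChangesSignIn (EI a b) v (Ico s t)) ∧
    (rightLim u s = 0 → leftLim u t * rightLim u t < 0 → 0 < omegaFn α β₁ t →
      PosMeasureOn (fun x => β₁ x - β₂ x) (Ioc s t) →
      ChangesSignIn (EI a b) v (Ioc s t)) ∧
    (leftLim u s * rightLim u s < 0 → rightLim u t = 0 →
      0 < omegaFn α β₁ s → 0 < omegaFn α β₁ t →
      PosMeasureOn (fun x => β₁ x - β₂ x) (Icc s t) →
      ChangesSignIn (EI a b) v (Icc s t)) ∧
    (leftLim u s = 0 → leftLim u t * rightLim u t < 0 →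
      0 < omegaFn α β₁ s → 0 < omegaFn α β₁ t →
      PosMeasureOn (fun x => β₁ x - β₂ x) (Icc s t) →
      ChangesSignIn (EI a b) v (Icc s t)) ∧
    (leftLim u s * rightLim u s < 0 → leftLim u t * rightLim u t < 0 →
      0 < omegaFn α β₁ s → 0 < omegaFn α β₁ t →
      PosMeasureOn (fun x => β₁ x - β₂ x) (Icc s t) →
      ChangesSignIn (EI a b) v (Icc s t)) := by
  push Not at hnv
  obtain ⟨x₀, hx₀, hv₀⟩ := hnv
  have hmin : min s x₀ ∈ EI a b := by
    rcases min_choice s x₀ with h | h <;> rw [h]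
    exacts [hs.1, hx₀]
  have hmax : max t x₀ ∈ EI a b := by
    rcases max_choice t x₀ with h | h <;> rw [h]
    exacts [ht.1, hx₀]
  obtain ⟨c, hc, d, hd, hcx, hxd⟩ := exists_Ioo_mem_EI hmin hmax
  have hcs : c < s := hcx.trans_le (min_le_left _ _)
  have htd : t < d := (le_max_left _ _).trans_lt hxd
  have hsub : Ioo c d ⊆ EI a b := Ioo_subset_Icc_self.trans (Icc_subset_EI hc hd)
  have hαv := hα.monotoneOn.locallyBoundedVariationOn
  obtain ⟨M, _, Hu, Hv⟩ := hu.exists_localSolution hv hαv hβ₁ hβ₂ hc hd (hcs.trans (hst.trans htd))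
  have hα' := IncreasingLims.of_strictMonoOn (hα.mono hsub)
    ((hasOneSidedLims_of_locallyBoundedVariationOn hαv).mono hsub)
  have key : ∀ {J : Set ℝ}, Ioo s t ⊆ J → J ⊆ Icc s t → J.OrdConnected →
      PosMeasureOn (fun x => β₁ x - β₂ x) J →
      (rightLim u s = 0 ∨ s ∈ J ∧ leftLim u s * rightLim u s ≤ 0 ∧ 0 < omegaFn α β₁ s) →
      (leftLim u t = 0 ∨ t ∈ J ∧ leftLim u t * rightLim u t ≤ 0 ∧ 0 < omegaFn α β₁ t) →
      (leftLim u s * rightLim u s < 0 ∨ leftLim u t * rightLim u t < 0) →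
      ChangesSignIn (EI a b) v J := fun hJ hJ' hJo hpos =>
    Hu.changesSignIn_of_zSet_eq_empty Hv hα'
      ((hasOneSidedLims_of_locallyBoundedVariationOn hβ₁).mono hsub)
      ((hasOneSidedLims_of_locallyBoundedVariationOn hβ₂).mono hsub) hsub
      ⟨hcs, hst.trans htd⟩ ⟨hcs.trans hst, htd⟩ hst hJ hJ' hJo (fun x hx => (hω x (hsub hx)).2)
      ⟨x₀, ⟨hcx.trans_le (min_le_right _ _), (le_max_right _ _).trans_lt hxd⟩, hv₀⟩ hpos hcons
  have hsI : s ∈ Icc s t := left_mem_Icc.2 hst.le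
  have htI : t ∈ Icc s t := right_mem_Icc.2 hst.le
  refine ⟨fun h1 h2 h3 hpos => ?_, fun h1 h2 h3 hpos => ?_, fun h1 _ h3 h4 hpos => ?_,
    fun _ h2 h3 h4 hpos => ?_, fun h1 _ h3 h4 hpos => ?_⟩
  · exact key Ioo_subset_Ico_self Ico_subset_Icc_self ordConnected_Ico hpos
      (.inr ⟨left_mem_Ico.2 hst, hs.2, h3⟩) (.inl h2) (.inl h1)
  · exact key Ioo_subset_Ioc_self Ioc_subset_Icc_self ordConnected_Ioc hpos
      (.inl h1) (.inr ⟨right_mem_Ioc.2 hst, ht.2, h3⟩) (.inr h2)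
  · exact key Ioo_subset_Icc_self Subset.rfl ordConnected_Icc hpos
      (.inr ⟨hsI, hs.2, h3⟩) (.inr ⟨htI, ht.2, h4⟩) (.inl h1)
  · exact key Ioo_subset_Icc_self Subset.rfl ordConnected_Icc hpos
      (.inr ⟨hsI, hs.2, h3⟩) (.inr ⟨htI, ht.2, h4⟩) (.inr h2)
  · exact key Ioo_subset_Icc_self Subset.rfl ordConnected_Icc hpos
      (.inr ⟨hsI, hs.2, h3⟩) (.inr ⟨htI, ht.2, h4⟩) (.inl h1)
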